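/- arXiv:1602.02609 — 2 statements merged into one kernel-verified Lean document; each statement's English description precedes it below -/
import Mathlib

section
/- Let n be a positive integer and let h be a left-continuous gauge function. Let K be a compact metric space such that dim_T U ≥ n and 𝒫^h(U) = ∞ for every non-empty open set U ⊆ K. Then for a generic f ∈ C(K,ℝⁿ), for every y in the interior of f(K), one has 𝒫^h(f⁻¹(y)) = ∞; moreover, the restriction of 𝒫^h to f⁻¹(y) is not σ-finite. -/
open Set Metric Filter Topology TopologicalSpace
open scoped ENNReal NNReal

noncomputable section

universe u

/-- `indBelow n X` means that the small inductive (topological) dimension of `X`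
is at most `n - 1`; in particular `indBelow 0 X` means `X = ∅`. -/
def indBelow : ℕ → ∀ (X : Type u) [TopologicalSpace X], Prop
  | 0, X, _ => IsEmpty X
  | n + 1, X, inst =>
      letI := inst
      ∀ (x : X) (U : Set X), IsOpen U → x ∈ U →
        ∃ V : Set X, IsOpen V ∧ x ∈ V ∧ V ⊆ U ∧ indBelow n ↥(frontier V)

/-- The small inductive (topological) dimension, with values in `EReal`:
`-1` for the empty space and `⊤` if there is no finite bound. -/
def indDim (X : Type u) [TopologicalSpace X] : EReal :=
  sInf {d : EReal | ∃ n : ℕ, indBelow n X ∧ d = (n : EReal) - 1}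

variable {X : Type u} [MetricSpace X]

/-- Topological dimension of a subset of a metric space. -/
def tdim (A : Set X) : EReal := indDim ↥A

open Classical in
/-- Hausdorff dimension of a subset of a metric space,
with the convention `dim ∅ = -1`. -/
def hdim (A : Set X) : EReal := if A = ∅ then -1 else ((dimH A : ℝ≥0∞) : EReal)

/-- A `δ`-packing of `A`: a countable family of pairwise disjoint closed balls
with centers in `A` and radii at most `δ`. -/
def IsPacking (A : Set X) (δ : ℝ≥0) (s : Set (X × ℝ≥0)) : Prop :=
  s.Countable ∧ (∀ p ∈ s, p.1 ∈ A ∧ p.2 ≤ δ) ∧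
    s.Pairwise fun p q => Disjoint (closedBall p.1 (p.2 : ℝ)) (closedBall q.1 (q.2 : ℝ))

/-- The packing pre-measure `P^h_δ(A)`. -/
def packPre (h : ℝ≥0 → ℝ≥0) (A : Set X) (δ : ℝ≥0) : ℝ≥0∞ :=
  ⨆ (s : Set (X × ℝ≥0)) (_ : IsPacking A δ s), ∑' p : s, ((h p.1.2 : ℝ≥0) : ℝ≥0∞)

/-- The packing pre-measure (packing number) `P^h₀(A) = lim_{δ → 0+} P^h_δ(A)`. -/
def packPre0 (h : ℝ≥0 → ℝ≥0) (A : Set X) : ℝ≥0∞ :=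
  ⨅ (δ : ℝ≥0) (_ : 0 < δ), packPre h A δ

/-- The `h`-packing measure `𝒫^h(A)`. -/
def packMeasure (h : ℝ≥0 → ℝ≥0) (A : Set X) : ℝ≥0∞ :=
  ⨅ (c : ℕ → Set X) (_ : A = ⋃ i, c i), ∑' i, packPre0 h (c i)

open Classical in
/-- The packing dimension, with the convention `dim ∅ = -1`. -/
def pdim (A : Set X) : EReal :=
  if A = ∅ then -1
  else max 0 (⨆ (s : ℝ≥0) (_ : packMeasure (fun r => r ^ (s : ℝ)) A = ∞), ((s : ℝ) : EReal))

/-- The restriction of the packing measure `𝒫^h` to `A` is σ-finite. -/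
def PackSigmaFiniteOn (h : ℝ≥0 → ℝ≥0) (A : Set X) : Prop :=
  ∃ c : ℕ → Set X, A ⊆ ⋃ i, c i ∧ ∀ i, packMeasure h (A ∩ c i) < ∞

/-- The generalized Hausdorff measure `ℋ^h(A)` associated to a gauge function `h`. -/
def hMeasure (h : ℝ≥0 → ℝ≥0) (A : Set X) : ℝ≥0∞ :=
  ⨆ (δ : ℝ≥0) (_ : 0 < δ),
    ⨅ (c : ℕ → Set X) (_ : A ⊆ ⋃ i, c i) (_ : ∀ i, EMetric.diam (c i) ≤ (δ : ℝ≥0∞)),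
      ∑' i, ((h (EMetric.diam (c i)).toNNReal : ℝ≥0) : ℝ≥0∞)

/-- `F` is an `F_σ` subset of the subspace `A`. -/
def IsFSigmaIn (F A : Set X) : Prop :=
  ∃ C : ℕ → Set X, (∀ i, IsClosed (C i)) ∧ F = ⋃ i, C i ∩ A

/-- `d^n_*(A) = inf {dim_*(A ∖ F) : F ⊆ A is F_σ in A and dim_T F ≤ n - 1}`. -/
def dStar (dim : Set X → EReal) (n : ℕ) (A : Set X) : EReal :=
  sInf {d : EReal |
    ∃ F : Set X, IsFSigmaIn F A ∧ tdim F ≤ (n : EReal) - 1 ∧ d = dim (A \ F)}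

end

section Packing

variable {X : Type*} [MetricSpace X]

/-- A finite indexed family of disjoint balls bounds the packing pre-measure from below. -/
theorem sum_le_packPre {ι : Type*} (h : ℝ≥0 → ℝ≥0) (A : Set X) (δ : ℝ≥0) (t : Finset ι)
    (x : ι → X) (r : ι → ℝ≥0) (hx : ∀ i ∈ t, x i ∈ A) (hr : ∀ i ∈ t, r i ≤ δ)
    (hd : (t : Set ι).Pairwise fun i j =>
      Disjoint (closedBall (x i) (r i : ℝ)) (closedBall (x j) (r j : ℝ))) :
    ∑ i ∈ t, (h (r i) : ℝ≥0∞) ≤ packPre h A δ := by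
  classical
  have hinj : Set.InjOn (fun i => (x i, r i)) (t : Set ι) := by
    intro i hi j hj hij
    by_contra hne
    have : Disjoint (closedBall (x i) (r i : ℝ)) (closedBall (x j) (r j : ℝ)) := hd hi hj hne
    simp only [Prod.mk.injEq] at hij
    rw [hij.1, hij.2] at this
    exact (Set.disjoint_left.1 this (mem_closedBall_self (r j).2)) (mem_closedBall_self (r j).2)
  have hpack :
      IsPacking A δ ((t.image fun i => (x i, r i) : Finset (X × ℝ≥0)) : Set (X × ℝ≥0)) := by
    refine ⟨Finset.countable_toSet _, ?_, ?_⟩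
    · intro p hp
      simp only [Finset.coe_image, Set.mem_image, Finset.mem_coe] at hp
      obtain ⟨i, hi, rfl⟩ := hp
      exact ⟨hx i hi, hr i hi⟩
    · intro p hp q hq hpq
      simp only [Finset.coe_image, Set.mem_image, Finset.mem_coe] at hp hq
      obtain ⟨i, hi, rfl⟩ := hp
      obtain ⟨j, hj, rfl⟩ := hq
      exact hd hi hj (fun hij => hpq (by rw [hij]))
  refine le_trans (le_of_eq ?_) (le_iSup₂_of_le _ hpack le_rfl)
  rw [Finset.tsum_subtype' (t.image fun i => (x i, r i)) (fun p => (h p.2 : ℝ≥0∞)),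
    Finset.sum_image hinj]

theorem exists_finset_of_lt_packPre {h : ℝ≥0 → ℝ≥0} {A : Set X} {δ : ℝ≥0} {c : ℝ≥0∞}
    (hc : c < packPre h A δ) :
    ∃ t : Finset (X × ℝ≥0), (∀ p ∈ t, p.1 ∈ A ∧ p.2 ≤ δ) ∧
      ((t : Set (X × ℝ≥0)).Pairwise fun p q =>
        Disjoint (closedBall p.1 (p.2 : ℝ)) (closedBall q.1 (q.2 : ℝ))) ∧
      c < ∑ p ∈ t, (h p.2 : ℝ≥0∞) := by
  classical
  simp only [packPre, lt_iSup_iff] at hc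
  obtain ⟨s, hs, hlt⟩ := hc
  rw [ENNReal.tsum_eq_iSup_sum, lt_iSup_iff] at hlt
  obtain ⟨t, ht⟩ := hlt
  refine ⟨t.map (Function.Embedding.subtype _), ?_, ?_, ?_⟩
  · intro p hp
    simp only [Finset.mem_map, Function.Embedding.subtype_apply] at hp
    obtain ⟨a, -, rfl⟩ := hp
    exact hs.2.1 a a.2
  · refine hs.2.2.mono ?_
    intro p hp
    simp only [Finset.coe_map, Set.mem_image] at hp
    obtain ⟨a, -, rfl⟩ := hp
    exact a.2
  · simpa using ht

/-- A finite family of disjoint balls stays disjoint after slightly moving the centers,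
at the cost of slightly smaller radii and an arbitrarily small loss in the sum. -/
theorem eventually_robust_packing [CompactSpace X] {h : ℝ≥0 → ℝ≥0}
    (hleft : ∀ r : ℝ≥0, Tendsto h (𝓝[<] r) (𝓝 (h r))) (t : Finset (X × ℝ≥0)) {c : ℝ≥0∞}
    (hd : (t : Set (X × ℝ≥0)).Pairwise fun p q =>
      Disjoint (closedBall p.1 (p.2 : ℝ)) (closedBall q.1 (q.2 : ℝ)))
    (hc : c < ∑ p ∈ t, (h p.2 : ℝ≥0∞)) :
    ∀ᶠ ε : ℝ≥0 in 𝓝[>] 0, c < ∑ p ∈ t, (h (p.2 - ε) : ℝ≥0∞) ∧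
      ∀ p ∈ t, ∀ q ∈ t, p ≠ q → ∀ x y, dist x p.1 < ε → dist y q.1 < ε →
        Disjoint (closedBall x ((p.2 - ε : ℝ≥0) : ℝ)) (closedBall y ((q.2 - ε : ℝ≥0) : ℝ)) := by
  have key : ∀ (x z : X) (p : X × ℝ≥0) (ε : ℝ≥0), dist x p.1 < ε →
      z ∈ closedBall x ((p.2 - ε : ℝ≥0) : ℝ) → z ∈ thickening ε (closedBall p.1 (p.2 : ℝ)) := by
    intro x z p ε hx hz
    rw [mem_closedBall] at hz
    rcases le_total ε p.2 with hle | hle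
    · rw [NNReal.coe_sub hle] at hz
      refine self_subset_thickening (lt_of_le_of_lt dist_nonneg hx) _ ?_
      rw [mem_closedBall]
      linarith [dist_triangle z x p.1]
    · rw [tsub_eq_zero_of_le hle, NNReal.coe_zero] at hz
      have hzx : z = x := dist_le_zero.1 hz
      subst hzx
      exact mem_thickening_iff.2 ⟨p.1, mem_closedBall_self p.2.2, hx⟩
  refine Filter.Eventually.and ?_ ?_
  · have htend : Tendsto (fun ε : ℝ≥0 => ∑ p ∈ t, (h (p.2 - ε) : ℝ≥0∞)) (𝓝[>] 0)
        (𝓝 (∑ p ∈ t, (h p.2 : ℝ≥0∞))) := by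
      refine tendsto_finsetSum _ fun p _ => ?_
      rw [ENNReal.tendsto_coe]
      rcases eq_or_ne p.2 0 with h0 | h0
      · simp [h0]
      · refine (hleft p.2).comp (tendsto_nhdsWithin_iff.2 ⟨?_, ?_⟩)
        · have : Tendsto (fun ε : ℝ≥0 => p.2 - ε) (𝓝 0) (𝓝 (p.2 - 0)) :=
            (continuous_const.sub continuous_id).tendsto 0
          rw [tsub_zero] at this
          exact this.mono_left nhdsWithin_le_nhds
        · filter_upwards [self_mem_nhdsWithin] with ε hε
          exact tsub_lt_self (pos_iff_ne_zero.2 h0) hε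
    exact htend.eventually (lt_mem_nhds hc)
  · rw [Filter.eventually_all_finset]
    intro p hp
    rw [Filter.eventually_all_finset]
    intro q hq
    rcases eq_or_ne p q with hpq | hpq
    · exact Filter.Eventually.of_forall fun ε hne => absurd hpq hne
    obtain ⟨d, hd0, hdisj⟩ := (hd hp hq hpq).exists_thickenings
      (isClosed_closedBall.isCompact) isClosed_closedBall
    have hsmall : ∀ᶠ ε : ℝ≥0 in 𝓝[>] 0, ε < d.toNNReal :=
      nhdsWithin_le_nhds (gt_mem_nhds (Real.toNNReal_pos.2 hd0))
    filter_upwards [hsmall] with ε hε _ x y hx hy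
    have hε' : (ε : ℝ) ≤ d := (Real.le_toNNReal_iff_coe_le hd0.le).1 hε.le
    refine Set.disjoint_left.2 fun z hzx hzy => Set.disjoint_left.1 hdisj
      (thickening_mono hε' _ (key x z p ε hx hzx)) (thickening_mono hε' _ (key y z q ε hy hzy))

theorem packPre_mono {h : ℝ≥0 → ℝ≥0} {A B : Set X} (hAB : A ⊆ B) (δ : ℝ≥0) :
    packPre h A δ ≤ packPre h B δ := by
  refine iSup₂_le fun s hs => ?_
  exact le_iSup₂_of_le s ⟨hs.1, fun p hp => ⟨hAB (hs.2.1 p hp).1, (hs.2.1 p hp).2⟩, hs.2.2⟩ le_rfl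

theorem packPre0_mono {h : ℝ≥0 → ℝ≥0} {A B : Set X} (hAB : A ⊆ B) :
    packPre0 h A ≤ packPre0 h B :=
  iInf₂_mono fun δ _ => packPre_mono hAB δ

theorem packPre0_empty (h : ℝ≥0 → ℝ≥0) : packPre0 h (∅ : Set X) = 0 := by
  refine le_antisymm (iInf₂_le_of_le 1 one_pos (iSup₂_le fun s hs => ?_)) zero_le
  have : s = ∅ := Set.eq_empty_of_forall_notMem fun p hp => (hs.2.1 p hp).1
  subst this
  simp

theorem packMeasure_le_packPre0 (h : ℝ≥0 → ℝ≥0) (A : Set X) :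
    packMeasure h A ≤ packPre0 h A := by
  classical
  refine iInf₂_le_of_le (fun i => if i = 0 then A else ∅) ?_ ?_
  · ext x
    simp
  · rw [tsum_eq_single 0]
    · simp
    · intro i hi
      simp [hi, packPre0_empty]

theorem packPre0_closure_le [CompactSpace X] {h : ℝ≥0 → ℝ≥0}
    (hleft : ∀ r : ℝ≥0, Tendsto h (𝓝[<] r) (𝓝 (h r))) (A : Set X) :
    packPre0 h (closure A) ≤ packPre0 h A := by
  refine iInf₂_mono fun δ _ => le_of_forall_lt fun c hc => ?_
  obtain ⟨t, ht, hd, hsum⟩ := exists_finset_of_lt_packPre hc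
  obtain ⟨ε, ⟨hε, hdisj⟩, hε0⟩ :=
    ((eventually_robust_packing hleft t hd hsum).and self_mem_nhdsWithin).exists
  have hex : ∀ p : X × ℝ≥0, ∃ x, p ∈ t → x ∈ A ∧ dist x p.1 < ε := by
    intro p
    by_cases hp : p ∈ t
    · obtain ⟨x, hx, hxp⟩ := Metric.mem_closure_iff.1 (ht p hp).1 ε hε0
      exact ⟨x, fun _ => ⟨hx, by rwa [dist_comm]⟩⟩
    · exact ⟨p.1, fun hp' => absurd hp' hp⟩
  choose x hx using hex
  refine hε.trans_le (sum_le_packPre h A δ t x (fun p => p.2 - ε) (fun p hp => (hx p hp).1)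
    (fun p hp => tsub_le_self.trans (ht p hp).2) fun p hp q hq hpq => ?_)
  exact hdisj p hp q hq hpq _ _ (hx p hp).2 (hx q hq).2

/-- If a non-empty closed subset of `A` has infinite packing pre-measure on all its portions,
then the packing measure is not σ-finite on `A`. -/
theorem not_packSigmaFiniteOn [CompactSpace X] {h : ℝ≥0 → ℝ≥0}
    (hleft : ∀ r : ℝ≥0, Tendsto h (𝓝[<] r) (𝓝 (h r))) {A C : Set X} (hC : IsClosed C)
    (hne : C.Nonempty) (hCA : C ⊆ A)
    (hinf : ∀ O : Set X, IsOpen O → (O ∩ C).Nonempty → packPre0 h (O ∩ C) = ∞) :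
    ¬ PackSigmaFiniteOn h A := by
  rintro ⟨c, hc, hfin⟩
  have hex : ∀ i, ∃ d : ℕ → Set X, A ∩ c i = ⋃ j, d j ∧ ∀ j, packPre0 h (d j) < ∞ := by
    intro i
    have := hfin i
    simp only [packMeasure, iInf_lt_iff] at this
    obtain ⟨d, hd, hlt⟩ := this
    exact ⟨d, hd, fun j => (ENNReal.le_tsum j).trans_lt hlt⟩
  choose d hd hdfin using hex
  have : CompactSpace C := isCompact_iff_compactSpace.1 hC.isCompact
  have : Nonempty C := hne.to_subtype
  have hcov : ⋃ q : ℕ × ℕ, ((↑) : C → X) ⁻¹' closure (d q.1 q.2) = Set.univ := by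
    refine Set.eq_univ_of_forall fun x => ?_
    obtain ⟨i, hi⟩ := Set.mem_iUnion.1 (hc (hCA x.2))
    have hmem : (x : X) ∈ ⋃ j, d i j := hd i ▸ ⟨hCA x.2, hi⟩
    obtain ⟨j, hj⟩ := Set.mem_iUnion.1 hmem
    exact Set.mem_iUnion.2 ⟨(i, j), subset_closure hj⟩
  obtain ⟨q, x, hx⟩ := nonempty_interior_of_iUnion_of_closed
    (fun q : ℕ × ℕ => isClosed_closure.preimage continuous_subtype_val) hcov
  obtain ⟨O', hO', hO'o, hxO'⟩ := mem_interior.1 hx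
  obtain ⟨O, hO, hOO'⟩ := isOpen_induced_iff.1 hO'o
  have hsub : O ∩ C ⊆ closure (d q.1 q.2) := by
    intro z hz
    have hz' : (⟨z, hz.2⟩ : C) ∈ O' := by
      rw [← hOO']
      exact hz.1
    exact hO' hz'
  have hxO : (x : X) ∈ O := by
    rw [← hOO'] at hxO'
    exact hxO'
  have hle : packPre0 h (O ∩ C) ≤ packPre0 h (d q.1 q.2) :=
    (packPre0_mono hsub).trans (packPre0_closure_le hleft _)
  rw [hinf O hO ⟨x, hxO, x.2⟩, top_le_iff] at hle
  exact (hdfin q.1 q.2).ne hle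

theorem packMeasure_eq_top_of_not_packSigmaFiniteOn {h : ℝ≥0 → ℝ≥0} {A : Set X}
    (hA : ¬ PackSigmaFiniteOn h A) : packMeasure h A = ∞ := by
  by_contra hne
  refine hA ⟨fun _ => A, fun x hx => Set.mem_iUnion.2 ⟨0, hx⟩, fun _ => ?_⟩
  rw [Set.inter_self]
  exact lt_top_iff_ne_top.2 hne

end Packing

section Dimension

universe v

/-- Every family of `n` pairs of disjoint closed sets, given as sub- and superlevel sets of
continuous functions, is inessential on every compact set. -/
def SignInessential (n : ℕ) (X : Type v) [TopologicalSpace X] : Prop :=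
  ∀ L : Set X, IsCompact L → ∀ φ : C(X, Fin n → ℝ), ∃ ψ : C(X, Fin n → ℝ),
    (∀ x ∈ L, ∀ i, (φ x i ≤ -1 → ψ x i < 0) ∧ (1 ≤ φ x i → 0 < ψ x i)) ∧ ∀ x ∈ L, ψ x ≠ 0

theorem SignInessential.exists_thin {X : Type v} [TopologicalSpace X] {n : ℕ}
    (hX : SignInessential (n + 1) X) {L : Set X} (hL : IsCompact L) (θ : C(X, ℝ))
    (τ : C(X, Fin n → ℝ)) :
    ∃ θ' : C(X, ℝ), (∀ x ∈ L, (θ x ≤ -1 → θ' x < -1) ∧ (1 ≤ θ x → 1 < θ' x)) ∧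
      ∃ ψ : C(X, Fin n → ℝ),
        (∀ x ∈ L, ∀ i, (τ x i ≤ -1 → ψ x i < 0) ∧ (1 ≤ τ x i → 0 < ψ x i)) ∧
        ∀ x ∈ L, |θ' x| ≤ 1 → ψ x ≠ 0 := by
  obtain ⟨ψ, hsign, hne⟩ := hX L hL
    ⟨fun x => Fin.cons (θ x) (τ x), θ.continuous.finCons τ.continuous⟩
  obtain ⟨c₁, hc₁, hle₁⟩ := hL.exists_forall_le' (f := fun x => ‖ψ x‖) (a := 0)
    (by fun_prop) (fun x hx => norm_pos_iff.2 (hne x hx))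
  have hsign0 : ∀ x ∈ L, (θ x ≤ -1 → ψ x 0 < 0) ∧ (1 ≤ θ x → 0 < ψ x 0) := fun x hx => by
    simpa using hsign x hx 0
  have hcl : IsCompact (L ∩ {x | 1 ≤ |θ x|}) :=
    hL.inter_right (isClosed_le continuous_const (by fun_prop))
  obtain ⟨c₂, hc₂, hle₂⟩ := hcl.exists_forall_le' (f := fun x => |ψ x 0|) (a := 0)
    (by fun_prop) (by
      rintro x ⟨hx, hθ⟩
      rcases le_abs'.1 (show 1 ≤ |θ x| from hθ) with h | h
      · exact abs_pos.2 ((hsign0 x hx).1 h).ne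
      · exact abs_pos.2 ((hsign0 x hx).2 h).ne')
  obtain ⟨c, hc0, hcc₁, hcc₂⟩ : ∃ c : ℝ, 0 < c ∧ c < c₁ ∧ c < c₂ :=
    ⟨min c₁ c₂ / 2, by positivity, by linarith [min_le_left c₁ c₂, lt_min hc₁ hc₂],
      by linarith [min_le_right c₁ c₂, lt_min hc₁ hc₂]⟩
  refine ⟨⟨fun x => ψ x 0 / c, by fun_prop⟩, fun x hx => ⟨fun h => ?_, fun h => ?_⟩,
    ⟨fun x i => ψ x i.succ, by fun_prop⟩, fun x hx i => by simpa using hsign x hx i.succ,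
    fun x hx hle h0 => ?_⟩
  · have h2 := hle₂ x ⟨hx, le_abs'.2 (Or.inl h)⟩
    have h3 := (hsign0 x hx).1 h
    rw [abs_of_neg h3] at h2
    change ψ x 0 / c < -1
    rw [div_lt_iff₀ hc0]
    linarith
  · have h2 := hle₂ x ⟨hx, le_abs'.2 (Or.inr h)⟩
    have h3 := (hsign0 x hx).2 h
    rw [abs_of_pos h3] at h2
    change 1 < ψ x 0 / c
    rw [lt_div_iff₀ hc0]
    linarith
  · change |ψ x 0 / c| ≤ 1 at hle
    rw [abs_div, abs_of_pos hc0, div_le_one hc0] at hle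
    have hnorm : ‖ψ x‖ ≤ c := by
      refine (pi_norm_le_iff_of_nonneg hc0.le).2 fun i => ?_
      refine Fin.cases ?_ (fun j => ?_) i
      · exact hle
      · have : ψ x j.succ = 0 := congrFun h0 j
        simp [this, hc0.le]
    linarith [hle₁ x hx]

/-- Being inessential in every `n`-tuple bounds the small inductive dimension. -/
theorem SignInessential.indBelow {n : ℕ} : ∀ {X : Type v} [MetricSpace X] [LocallyCompactSpace X]
    [SecondCountableTopology X], SignInessential n X → indBelow n X := by
  induction n with
  | zero =>
    intro X _ _ _ hX
    refine ⟨fun x => ?_⟩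
    obtain ⟨ψ, -, hψ⟩ := hX {x} isCompact_singleton 0
    exact hψ x rfl (Subsingleton.elim _ _)
  | succ n ih =>
    intro X _ _ _ hX x U hU hxU
    obtain ⟨L, hL, hxL, hLU⟩ := exists_compact_subset hU hxU
    obtain ⟨θ₀, hθx, hθL⟩ : ∃ θ₀ : C(X, ℝ), θ₀ x ≤ -1 ∧ ∀ z ∉ interior L, 1 ≤ θ₀ z := by
      obtain ⟨f, hf0, hf1, -⟩ := exists_continuous_zero_one_of_isClosed
        (isClosed_singleton (x := x))
        isOpen_interior.isClosed_compl (by simpa using hxL)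
      refine ⟨⟨fun z => 2 * f z - 1, by fun_prop⟩, ?_, fun z hz => ?_⟩
      · have : f x = 0 := hf0 rfl
        simp [this]
      · have : f z = 1 := hf1 hz
        norm_num [this]
    choose step hstep ψ hψsign hψne using fun θ τ => hX.exists_thin hL θ τ
    let τ := denseSeq C(X, Fin n → ℝ)
    let θ : ℕ → C(X, ℝ) := fun k => Nat.rec θ₀ (fun k θ => step θ (τ k)) k
    have hθs : ∀ k, θ (k + 1) = step (θ k) (τ k) := fun k => rfl
    have hneg : ∀ z ∈ L, ∀ j k, j < k → θ j z ≤ -1 → θ k z < -1 := by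
      intro z hz j k hjk
      induction k, hjk using Nat.le_induction with
      | base => exact fun h => (hstep (θ j) (τ j) z hz).1 h
      | succ k _ ihk => exact fun h => (hstep (θ k) (τ k) z hz).1 (ihk h).le
    have hpos : ∀ z ∈ L, ∀ j k, j < k → 1 ≤ θ j z → 1 < θ k z := by
      intro z hz j k hjk
      induction k, hjk using Nat.le_induction with
      | base => exact fun h => (hstep (θ j) (τ j) z hz).2 h
      | succ k _ ihk => exact fun h => (hstep (θ k) (τ k) z hz).2 (ihk h).le
    let V : Set X := ⋃ k : ℕ, interior L ∩ {z | θ (k + 1) z < -1}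
    have hV : IsOpen V := isOpen_iUnion fun k =>
      isOpen_interior.inter (isOpen_lt (by fun_prop) continuous_const)
    have hVL : V ⊆ L := Set.iUnion_subset fun k => Set.inter_subset_left.trans interior_subset
    have hfr : ∀ z ∈ frontier V, z ∈ L ∧ ∀ k, |θ (k + 1) z| ≤ 1 := by
      intro z hz
      have hzL : z ∈ L := hL.isClosed.closure_subset_iff.2 hVL hz.1
      have hzV : z ∉ V := by
        have := hz.2
        rwa [hV.interior_eq] at this
      refine ⟨hzL, fun k => abs_le.2 ⟨?_, ?_⟩⟩
      · by_contra! hlt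
        refine hzV (Set.mem_iUnion.2 ⟨k, ?_, hlt⟩)
        by_contra hzi
        have := hpos z hzL 0 (k + 1) k.succ_pos (hθL z hzi)
        linarith
      · by_contra! hlt
        obtain ⟨w, hw, hwV⟩ := mem_closure_iff.1 hz.1 {w | 1 < θ (k + 1) w}
          (isOpen_lt continuous_const (by fun_prop)) hlt
        obtain ⟨j, hwi, hj⟩ := Set.mem_iUnion.1 hwV
        have hwL := interior_subset hwi
        have h1 := hpos w hwL (k + 1) (k + j + 2) (by omega) (le_of_lt hw)
        have h2 := hneg w hwL (j + 1) (k + j + 2) (by omega) (le_of_lt hj)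
        linarith
    have hcl : IsClosed (frontier V) := isClosed_frontier
    have : LocallyCompactSpace (frontier V) := hcl.locallyCompactSpace
    refine ⟨V, hV, Set.mem_iUnion.2 ⟨0, hxL, (hstep θ₀ (τ 0) x (interior_subset hxL)).1 hθx⟩,
      hVL.trans hLU, ih fun L' hL' φ => ?_⟩
    obtain ⟨Φ, hΦ⟩ := ContinuousMap.exists_restrict_eq hcl φ
    have : CompactSpace L := isCompact_iff_compactSpace.1 hL
    obtain ⟨k, hk⟩ := (denseRange_denseSeq C(X, Fin n → ℝ)).exists_mem_open
      ((isOpen_ball (x := ((2 : ℝ) • Φ).restrict L) (ε := 1)).preimage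
        (ContinuousMap.continuous_restrict L)) ⟨(2 : ℝ) • Φ, mem_ball_self one_pos⟩
    have hk' : ∀ z ∈ L, ∀ i, |τ k z i - 2 * Φ z i| < 1 := by
      intro z hz i
      have h1 := (dist_le_pi_dist _ _ i).trans_lt
        ((ContinuousMap.dist_apply_le_dist ⟨z, hz⟩).trans_lt (mem_ball.1 hk))
      simpa [Real.dist_eq] using h1
    refine ⟨(ψ (θ k) (τ k)).restrict (frontier V), fun z _ i => ?_, fun z _ => ?_⟩
    · have hzL := (hfr z z.2).1
      have hφ : φ z = Φ z := by rw [← hΦ]; rfl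
      have habs := abs_lt.1 (hk' z hzL i)
      have hs := hψsign (θ k) (τ k) z hzL i
      rw [hφ]
      exact ⟨fun h => hs.1 (by linarith), fun h => hs.2 (by linarith)⟩
    · exact hψne (θ k) (τ k) z (hfr z z.2).1 ((hfr z z.2).2 k)

/-- Open sets of large dimension contain compact sets supporting an essential map. -/
theorem exists_essential {K : Type v} [MetricSpace K] [CompactSpace K] {n : ℕ} {W : Set K}
    (hW : IsOpen W) (hdim : (n : EReal) ≤ tdim W) :
    ∃ L ⊆ W, IsCompact L ∧ ∃ φ : C(K, Fin n → ℝ), ∀ ψ : C(K, Fin n → ℝ),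
      (∀ x ∈ L, ∀ i, (φ x i ≤ -1 → ψ x i < 0) ∧ (1 ≤ φ x i → 0 < ψ x i)) → ∃ x ∈ L, ψ x = 0 := by
  have : LocallyCompactSpace W := hW.locallyCompactSpace
  have hnot : ¬ SignInessential n W := by
    intro hs
    have hle : tdim W ≤ (n : EReal) - 1 := sInf_le ⟨n, hs.indBelow, rfl⟩
    have hcoe : (n : EReal) - 1 = ((n - 1 : ℝ) : EReal) := by
      rw [EReal.coe_sub]
      rfl
    have h2 := hdim.trans hle
    rw [hcoe, ← EReal.coe_natCast, EReal.coe_le_coe_iff] at h2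
    linarith
  simp only [SignInessential] at hnot
  push Not at hnot
  obtain ⟨L, hL, φ, hφ⟩ := hnot
  have hL' : IsCompact (((↑) : W → K) '' L) := hL.image continuous_subtype_val
  have : CompactSpace L := isCompact_iff_compactSpace.1 hL
  have hemb : IsClosedEmbedding (fun x : L => ((x : W) : K)) :=
    (continuous_subtype_val.comp continuous_subtype_val).isClosedEmbedding
      (Subtype.val_injective.comp Subtype.val_injective)
  obtain ⟨Φ, hΦ⟩ := ContinuousMap.exists_extension' hemb (φ.restrict L)
  have hΦ' : ∀ x (hx : x ∈ L), Φ x = φ x := fun x hx => congrFun hΦ ⟨x, hx⟩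
  refine ⟨_, Subtype.coe_image_subset W L, hL', Φ, fun ψ hψ => ?_⟩
  obtain ⟨x, hx, h0⟩ := hφ (ψ.restrict W) (fun x hx i => by
    have := hψ x (Set.mem_image_of_mem _ hx) i
    rwa [hΦ' x hx] at this)
  exact ⟨x, Set.mem_image_of_mem _ hx, h0⟩

end Dimension

section Perturbation

/-- A continuous map can be replaced by prescribed maps on finitely many disjoint open sets,
up to interpolation away from given closed subsets. -/
theorem exists_glue {K : Type*} [TopologicalSpace K] [NormalSpace K] {E : Type*}
    [NormedAddCommGroup E] [NormedSpace ℝ E] {ι : Type*} [Fintype ι] (W L : ι → Set K)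
    (hW : ∀ i, IsOpen (W i)) (hL : ∀ i, IsClosed (L i)) (hLW : ∀ i, L i ⊆ W i)
    (hdisj : Pairwise fun i j => Disjoint (W i) (W j)) (f : C(K, E)) (Φ : ι → C(K, E)) :
    ∃ g : C(K, E), (∀ x, (∀ i, x ∉ W i) → g x = f x) ∧
      (∀ i, ∀ x ∈ W i, g x ∈ segment ℝ (f x) (Φ i x)) ∧ ∀ i, ∀ x ∈ L i, g x = Φ i x := by
  classical
  have hu : ∀ i, ∃ u : C(K, ℝ), EqOn u 0 (W i)ᶜ ∧ EqOn u 1 (L i) ∧ ∀ x, u x ∈ Icc (0 : ℝ) 1 :=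
    fun i => exists_continuous_zero_one_of_isClosed (hW i).isClosed_compl (hL i)
      (Set.disjoint_left.2 fun x hx hxL => hx (hLW i hxL))
  choose u hu0 hu1 hu using hu
  let g : C(K, E) := ⟨fun x => f x + ∑ i, u i x • (Φ i x - f x), by fun_prop⟩
  have hg : ∀ i, ∀ x ∈ W i, g x = f x + u i x • (Φ i x - f x) := by
    intro i x hx
    change f x + ∑ j, u j x • (Φ j x - f x) = _
    rw [Finset.sum_eq_single i]
    · intro j _ hj
      have : u j x = 0 := hu0 j fun hxj => Set.disjoint_left.1 (hdisj hj) hxj hx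
      rw [this, zero_smul]
    · simp
  refine ⟨g, fun x hx => ?_, fun i x hx => ?_, fun i x hx => ?_⟩
  · change f x + ∑ j, u j x • (Φ j x - f x) = _
    rw [Finset.sum_eq_zero, add_zero]
    intro j _
    have : u j x = 0 := hu0 j (hx j)
    rw [this, zero_smul]
  · rw [hg i x hx, segment_eq_image']
    exact ⟨u i x, hu i x, rfl⟩
  · have : u i x = 1 := hu1 i hx
    rw [hg i x (hLW i hx), this]
    simp

/-- A finite family of reals can be made injective by a small perturbation. -/
theorem exists_injective_perturbation {ι : Type*} [Finite ι] (c : ι → ℝ) {ε : ℝ} (hε : 0 < ε) :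
    ∃ c' : ι → ℝ, Function.Injective c' ∧ ∀ k, |c' k - c k| < ε := by
  obtain ⟨N, ⟨e⟩⟩ := Finite.exists_equiv_fin ι
  let v : ι → ℝ := fun k => ((e k : ℕ) : ℝ)
  have hv : Function.Injective v := fun k l hkl => e.injective (Fin.ext (Nat.cast_injective hkl))
  have hfin : (Set.range fun q : ι × ι => (c q.2 - c q.1) / (v q.1 - v q.2)).Finite :=
    Set.finite_range _
  obtain ⟨s, hs, hsn⟩ :=
    (Set.Ioo_infinite (show (0 : ℝ) < ε / (N + 1) by positivity)).exists_notMem_finite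
    hfin
  refine ⟨fun k => c k + s * v k, fun k l hkl => ?_, fun k => ?_⟩
  · by_contra hne
    refine hsn ⟨(k, l), ?_⟩
    have hsub : v k - v l ≠ 0 := sub_ne_zero.2 (hv.ne hne)
    change (c l - c k) / (v k - v l) = s
    rw [div_eq_iff hsub]
    change c k + s * v k = c l + s * v l at hkl
    linarith
  · have hvN : v k < N + 1 := by
      have : ((e k : ℕ) : ℝ) < N := by exact_mod_cast (e k).2
      change ((e k : ℕ) : ℝ) < N + 1
      linarith
    have hv0 : 0 ≤ v k := Nat.cast_nonneg _
    rw [add_sub_cancel_left, abs_of_nonneg (mul_nonneg hs.1.le hv0)]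
    calc s * v k < s * (N + 1) := by gcongr; exact hs.1
      _ < ε := (lt_div_iff₀ (by positivity)).1 hs.2

/-- If finitely many boxes, no two faces of which lie on a common hyperplane up to `5 * η`,
cover a ball up to `η`, then the center of the ball is `η`-deep in one of them. -/
theorem exists_deep_box {ι : Type*} {n : ℕ} (c : Fin n → ι × Bool → ℝ) {η r : ℝ} (hη : 0 < η)
    (hr : 3 * η < r) (hsep : ∀ i k l, k ≠ l → 5 * η < |c i k - c i l|) (J : Set ι)
    (y : Fin n → ℝ)
    (hcov : ∀ z ∈ ball y r, ∃ j ∈ J, ∀ i, c i (j, false) - η ≤ z i ∧ z i ≤ c i (j, true) + η) :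
    ∃ j ∈ J, ∀ i, c i (j, false) + η < y i ∧ y i < c i (j, true) - η := by
  by_contra! hcon
  have huniq : ∀ i k l, |y i - c i k| ≤ η → |y i - c i l| ≤ 4 * η → k = l := by
    intro i k l hk hl
    by_contra hne
    have h1 := hsep i k l hne
    have h2 := abs_sub_le (c i k) (y i) (c i l)
    rw [abs_sub_comm (c i k) (y i)] at h2
    linarith
  have hz : ∀ i, ∃ s : ℝ, |s| ≤ 3 * η ∧ (∀ j, |y i - c i (j, false)| ≤ η → s = -(3 * η)) ∧
      (∀ j, |y i - c i (j, true)| ≤ η → s = 3 * η) ∧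
      (0 < s → ∃ j, |y i - c i (j, true)| ≤ η) ∧ (s < 0 → ∃ j, |y i - c i (j, false)| ≤ η) := by
    intro i
    by_cases h1 : ∃ j, |y i - c i (j, false)| ≤ η
    · obtain ⟨j, hj⟩ := h1
      refine ⟨-(3 * η), by rw [abs_neg, abs_of_pos (by positivity)], fun _ _ => rfl,
        fun j' hj' => ?_, fun h => by linarith, fun _ => ⟨j, hj⟩⟩
      simpa using huniq i _ _ hj (hj'.trans (by linarith))
    · by_cases h2 : ∃ j, |y i - c i (j, true)| ≤ η
      · obtain ⟨j, hj⟩ := h2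
        exact ⟨3 * η, by rw [abs_of_pos (by positivity)], fun j' hj' => absurd ⟨j', hj'⟩ h1,
          fun _ _ => rfl, fun _ => ⟨j, hj⟩, fun h => by linarith⟩
      · exact ⟨0, by simpa using hη.le, fun j' hj' => absurd ⟨j', hj'⟩ h1,
          fun j' hj' => absurd ⟨j', hj'⟩ h2, fun h => absurd h (lt_irrefl _),
          fun h => absurd h (lt_irrefl _)⟩
  choose s hs hs1 hs2 hs3 hs4 using hz
  obtain ⟨j, hj, hbox⟩ := hcov (fun i => y i + s i) (by
    refine mem_ball.2 (lt_of_le_of_lt ((dist_pi_le_iff (by positivity)).2 fun i => ?_) hr)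
    simpa [Real.dist_eq] using hs i)
  obtain ⟨i, hi⟩ := hcon j hj
  obtain ⟨hlow, hupp⟩ := hbox i
  have hsi := abs_le.1 (hs i)
  by_cases hlt : c i (j, false) + η < y i
  · have hge := hi hlt
    by_cases hnear : |y i - c i (j, true)| ≤ η
    · linarith [hs2 i j hnear]
    · have hfar : c i (j, true) + η < y i := by
        by_contra! hle
        exact hnear (abs_le.2 ⟨by linarith, by linarith⟩)
      obtain ⟨j', hj'⟩ := hs4 i (by linarith)
      simpa using huniq i _ (j, true) hj' (abs_le.2 ⟨by linarith, by linarith⟩)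
  · by_cases hnear : |y i - c i (j, false)| ≤ η
    · linarith [hs1 i j hnear]
    · have hfar : y i < c i (j, false) - η := by
        by_contra! hle
        exact hnear (abs_le.2 ⟨by linarith, by linarith⟩)
      obtain ⟨j', hj'⟩ := hs3 i (by linarith)
      simpa using huniq i _ (j, false) hj' (abs_le.2 ⟨by linarith, by linarith⟩)

end Perturbation

section Generic

variable {K : Type*} [MetricSpace K] {n : ℕ} {h : ℝ≥0 → ℝ≥0}

/-- Whenever `f '' W` contains a ball of radius `1 / (m + 1)` around `y`, there is a packing with
large sum near `W`, stable under small changes of its centers, such that `y` is an interior value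
of `f` near each center. -/
def HasFiberPackings (h : ℝ≥0 → ℝ≥0) (m : ℕ) (f : C(K, Fin n → ℝ)) : Prop :=
  ∀ (W : Set K) (y : Fin n → ℝ), ball y (1 / (m + 1)) ⊆ f '' W →
    ∃ (t : Finset (K × ℝ≥0)) (ε : ℝ≥0), (m : ℝ≥0∞) < ∑ p ∈ t, (h (p.2 - ε) : ℝ≥0∞) ∧
      (∀ p ∈ t, ∀ q ∈ t, p ≠ q → ∀ x y, dist x p.1 < ε → dist y q.1 < ε →
        Disjoint (closedBall x ((p.2 - ε : ℝ≥0) : ℝ)) (closedBall y ((q.2 - ε : ℝ≥0) : ℝ))) ∧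
      ∀ p ∈ t, (p.2 : ℝ) ≤ 1 / (m + 1) ∧ 0 < ε ∧ (ε : ℝ) ≤ 1 / (m + 1) ∧
        ball p.1 ε ⊆ thickening (1 / (m + 1)) W ∧ y ∈ interior (f '' ball p.1 (ε / 2))

theorem exists_robust_packing [CompactSpace K]
    (hleft : ∀ r : ℝ≥0, Tendsto h (𝓝[<] r) (𝓝 (h r))) {U : Set K}
    (hU : IsOpen U) (hinf : packPre0 h U = ∞) (m : ℕ) {r : ℝ} (hr : 0 < r) :
    ∃ (t : Finset (K × ℝ≥0)) (ε : ℝ≥0), 0 < ε ∧ (ε : ℝ) ≤ r ∧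
      (m : ℝ≥0∞) < ∑ p ∈ t, (h (p.2 - ε) : ℝ≥0∞) ∧
      (∀ p ∈ t, ∀ q ∈ t, p ≠ q → ∀ x y, dist x p.1 < ε → dist y q.1 < ε →
        Disjoint (closedBall x ((p.2 - ε : ℝ≥0) : ℝ)) (closedBall y ((q.2 - ε : ℝ≥0) : ℝ))) ∧
      ∀ p ∈ t, (p.2 : ℝ) ≤ r ∧ ball p.1 ε ⊆ U := by
  have htop : packPre h U r.toNNReal = ∞ :=
    top_le_iff.1 (hinf ▸ iInf₂_le r.toNNReal (Real.toNNReal_pos.2 hr))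
  obtain ⟨t, ht, hd, hsum⟩ := exists_finset_of_lt_packPre (h := h) (A := U) (δ := r.toNNReal)
    (c := (m : ℝ≥0∞)) (by rw [htop]; exact ENNReal.natCast_lt_top m)
  have hball : ∀ᶠ ε : ℝ≥0 in 𝓝[>] 0, ∀ p ∈ t, ball p.1 (ε : ℝ) ⊆ U := by
    rw [Filter.eventually_all_finset]
    intro p hp
    obtain ⟨d, hd0, hdU⟩ := Metric.isOpen_iff.1 hU p.1 (ht p hp).1
    have hsmall : ∀ᶠ ε : ℝ≥0 in 𝓝[>] 0, ε < d.toNNReal :=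
      nhdsWithin_le_nhds (gt_mem_nhds (Real.toNNReal_pos.2 hd0))
    filter_upwards [hsmall] with ε hε
    exact (ball_subset_ball ((Real.le_toNNReal_iff_coe_le hd0.le).1 hε.le)).trans hdU
  have hεr : ∀ᶠ ε : ℝ≥0 in 𝓝[>] 0, ε < r.toNNReal :=
    nhdsWithin_le_nhds (gt_mem_nhds (Real.toNNReal_pos.2 hr))
  obtain ⟨ε, ⟨⟨⟨h1, h2⟩, h3⟩, h4⟩, h5⟩ := ((((eventually_robust_packing hleft t hd hsum).and
    hball).and self_mem_nhdsWithin).and hεr).exists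
  exact ⟨t, ε, h4, (Real.le_toNNReal_iff_coe_le hr.le).1 h5.le, h1, h2, fun p hp =>
    ⟨(Real.le_toNNReal_iff_coe_le hr.le).1 (ht p hp).2, h3 p hp⟩⟩

/-- A compact metric space has a finite net whose points are far from each other. -/
theorem exists_finite_separated_net (K : Type*) [MetricSpace K] [CompactSpace K] {δ : ℝ}
    (hδ : 0 < δ) :
    ∃ T : Set K, T.Finite ∧ (∀ x ∈ T, ∀ y ∈ T, x ≠ y → δ < dist x y) ∧
      ∀ x, ∃ y ∈ T, dist x y ≤ δ := by
  obtain ⟨r, hr⟩ : ∃ r : ℝ≥0, (2 * r : ℝ≥0) = δ :=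
    ⟨(δ / 2).toNNReal, by rw [NNReal.coe_mul, Real.coe_toNNReal _ (by positivity)]; simp; ring⟩
  have hr0 : r ≠ 0 := by
    rintro rfl
    simp at hr
    linarith
  obtain ⟨N, -, hN, hcov⟩ := exists_finite_isCover_of_isCompact hr0 (isCompact_univ (X := K))
  have htop : packingNumber (2 * r) (Set.univ : Set K) ≠ ⊤ :=
    ((packingNumber_two_mul_le_externalCoveringNumber r _).trans_lt
      ((hcov.externalCoveringNumber_le_encard).trans_lt hN.encard_lt_top)).ne
  have he : ∀ x y : K, edist x y ≤ (2 * r : ℝ≥0) ↔ dist x y ≤ δ := fun x y => by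
    rw [edist_nndist, ENNReal.coe_le_coe, ← hr, ← NNReal.coe_le_coe, coe_nndist]
  refine ⟨maximalSeparatedSet (2 * r) Set.univ, ?_, fun x hx y hy hxy => ?_, fun x => ?_⟩
  · rw [← Set.encard_ne_top_iff, encard_maximalSeparatedSet htop]
    exact htop
  · have := isSeparated_maximalSeparatedSet hx hy hxy
    by_contra! hle
    exact absurd this (not_lt.2 ((he x y).2 hle))
  · obtain ⟨y, hy, hxy⟩ := isCover_maximalSeparatedSet htop (Set.mem_univ x)
    exact ⟨y, hy, (he x y).1 hxy⟩

/-- The affine image of the truncation of a map to `[-1, 1]ⁿ` in the box `[a, b]`. -/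
theorem exists_box_map {a b : Fin n → ℝ} (hab : ∀ i, a i ≤ b i) (φ : C(K, Fin n → ℝ)) :
    ∃ Φ : C(K, Fin n → ℝ), ∀ x, Φ x ∈ Icc a b ∧
      ∀ i, (φ x i ≤ -1 → Φ x i = a i) ∧ (1 ≤ φ x i → Φ x i = b i) := by
  refine ⟨⟨fun x i => a i + (b i - a i) * ((max (-1) (min 1 (φ x i)) + 1) / 2), by fun_prop⟩,
    fun x => ⟨⟨fun i => ?_, fun i => ?_⟩, fun i => ⟨fun hi => ?_, fun hi => ?_⟩⟩⟩
  · have h1 : -1 ≤ max (-1) (min 1 (φ x i)) := le_max_left _ _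
    have h2 : 0 ≤ (b i - a i) * ((max (-1) (min 1 (φ x i)) + 1) / 2) :=
      mul_nonneg (sub_nonneg.2 (hab i)) (by linarith)
    simpa using h2
  · have h1 : max (-1) (min 1 (φ x i)) ≤ 1 := max_le (by norm_num) (min_le_left _ _)
    have h2 : (b i - a i) * ((max (-1) (min 1 (φ x i)) + 1) / 2) ≤ (b i - a i) * 1 :=
      mul_le_mul_of_nonneg_left (by linarith) (sub_nonneg.2 (hab i))
    change a i + (b i - a i) * ((max (-1) (min 1 (φ x i)) + 1) / 2) ≤ b i
    linarith
  · have h1 : max (-1) (min 1 (φ x i)) = -1 := max_eq_left ((min_le_right _ _).trans hi)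
    change a i + (b i - a i) * ((max (-1) (min 1 (φ x i)) + 1) / 2) = a i
    rw [h1]
    ring
  · have h1 : max (-1) (min 1 (φ x i)) = 1 := by rw [min_eq_left hi]; norm_num
    change a i + (b i - a i) * ((max (-1) (min 1 (φ x i)) + 1) / 2) = b i
    rw [h1]
    ring

theorem exists_hasFiberPackings_near [CompactSpace K]
    (hleft : ∀ r : ℝ≥0, Tendsto h (𝓝[<] r) (𝓝 (h r)))
    (hK : ∀ U : Set K, IsOpen U → U.Nonempty → (n : EReal) ≤ tdim U ∧ packMeasure h U = ∞)
    (m : ℕ) (f₀ : C(K, Fin n → ℝ)) {ε : ℝ} (hε : 0 < ε) :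
    ∃ g : C(K, Fin n → ℝ), dist g f₀ < ε ∧
      ∃ η > 0, ∀ f : C(K, Fin n → ℝ), dist f g < η → HasFiberPackings h m f := by
  classical
  have hr : (0 : ℝ) < 1 / (m + 1) := by positivity
  set r : ℝ := 1 / (m + 1) with hrdef
  obtain ⟨δ₀, hδ₀, hosc⟩ := Metric.uniformContinuous_iff.1
    (CompactSpace.uniformContinuous_of_continuous f₀.continuous) (ε / 8) (by positivity)
  obtain ⟨δ, hδ, hδδ₀, hδr⟩ : ∃ δ : ℝ, 0 < δ ∧ δ < δ₀ ∧ δ ≤ r / 2 :=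
    ⟨min (δ₀ / 2) (r / 2), by positivity, by linarith [min_le_left (δ₀ / 2) (r / 2)],
      min_le_right _ _⟩
  obtain ⟨T, hT, hsep, hcov⟩ := exists_finite_separated_net K hδ
  have : Fintype T := hT.fintype
  have hc : ∀ i : Fin n, ∃ c : T × Bool → ℝ, Function.Injective c ∧
      ∀ k, |c k - (f₀ k.1 i + if k.2 then ε / 4 else -(ε / 4))| < ε / 8 :=
    fun i => exists_injective_perturbation _ (by positivity)
  choose c hcinj hcnear using hc
  have hcf : ∀ i (j : T), |c i (j, false) - (f₀ j i - ε / 4)| < ε / 8 := fun i j => by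
    simpa [sub_eq_add_neg] using hcnear i (j, false)
  have hct : ∀ i (j : T), |c i (j, true) - (f₀ j i + ε / 4)| < ε / 8 := fun i j => by
    simpa using hcnear i (j, true)
  let a : T → Fin n → ℝ := fun j i => c i (j, false)
  let b : T → Fin n → ℝ := fun j i => c i (j, true)
  have hab : ∀ j i, a j i ≤ b j i := fun j i => by
    have h1 := abs_lt.1 (hcf i j)
    have h2 := abs_lt.1 (hct i j)
    change c i (j, false) ≤ c i (j, true)
    linarith
  have hside : ∀ j i, b j i - a j i < 3 / 4 * ε := fun j i => by
    have h1 := abs_lt.1 (hcf i j)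
    have h2 := abs_lt.1 (hct i j)
    change c i (j, true) - c i (j, false) < _
    linarith
  have hf₀box : ∀ (j : T) (x : K), dist x (j : K) ≤ δ → f₀ x ∈ Icc (a j) (b j) := by
    intro j x hx
    have hd : ∀ i, |f₀ x i - f₀ j i| < ε / 8 := fun i =>
      (dist_le_pi_dist (f₀ x) (f₀ j) i).trans_lt (hosc (hx.trans_lt hδδ₀))
    refine ⟨fun i => ?_, fun i => ?_⟩
    · have h1 := abs_lt.1 (hcf i j)
      have h2 := abs_lt.1 (hd i)
      change c i (j, false) ≤ f₀ x i
      linarith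
    · have h1 := abs_lt.1 (hct i j)
      have h2 := abs_lt.1 (hd i)
      change f₀ x i ≤ c i (j, true)
      linarith
  have hpack := fun j : T => exists_robust_packing hleft (isOpen_ball (x := (j : K)) (ε := δ / 2))
    (top_le_iff.1 ((hK (ball (j : K) (δ / 2)) isOpen_ball
      ⟨j, mem_ball_self (by positivity)⟩).2 ▸ packMeasure_le_packPre0 h _)) m hr
  choose t e he her hsum hdisj ht using hpack
  have he' : ∀ j, (0 : ℝ) < e j := fun j => NNReal.coe_pos.2 (he j)
  have hess := fun q : (Σ j : T, t j) =>
    exists_essential (isOpen_ball (x := (q.2 : K × ℝ≥0).1) (ε := (e q.1 : ℝ) / 2))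
      (hK _ isOpen_ball ⟨_, mem_ball_self (half_pos (he' q.1))⟩).1
  choose L hLW hL φ hφ using hess
  have hbox := fun q : (Σ j : T, t j) => exists_box_map (hab q.1) (φ q)
  choose Φ hΦ using hbox
  have hhalf : ∀ (j : T) (p : K × ℝ≥0), ball p.1 ((e j : ℝ) / 2) ⊆ ball p.1 (e j) :=
    fun j p => ball_subset_ball (half_le_self (he' j).le)
  obtain ⟨g, hgout, hgW, hgL⟩ := exists_glue
    (fun q : (Σ j : T, t j) => ball (q.2 : K × ℝ≥0).1 ((e q.1 : ℝ) / 2)) L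
    (fun q => isOpen_ball) (fun q => (hL q).isClosed) hLW (by
      rintro ⟨j, p, hp⟩ ⟨k, q, hq⟩ hne
      refine Set.disjoint_left.2 fun x hx hx' => ?_
      have hxj := (ht j p hp).2 (hhalf j p hx)
      have hxk := (ht k q hq).2 (hhalf k q hx')
      by_cases hjk : j = k
      · subst hjk
        have hpq : p ≠ q := fun hpq => hne (by subst hpq; rfl)
        exact Set.disjoint_left.1 (hdisj j p hp q hq hpq x x (hhalf j p hx) (hhalf j q hx'))
          (mem_closedBall_self NNReal.zero_le_coe) (mem_closedBall_self NNReal.zero_le_coe)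
      · have h1 := hsep j j.2 k k.2 (fun h => hjk (Subtype.ext h))
        have h2 := dist_triangle_left (j : K) k x
        rw [mem_ball] at hxj hxk
        linarith) f₀ Φ
  have hboth : ∀ x : K, ∃ j : T, dist x (j : K) ≤ δ ∧ f₀ x ∈ Icc (a j) (b j) ∧
      g x ∈ Icc (a j) (b j) := by
    intro x
    by_cases hx : ∃ q : (Σ j : T, t j), x ∈ ball (q.2 : K × ℝ≥0).1 ((e q.1 : ℝ) / 2)
    · obtain ⟨q, hq⟩ := hx
      have hxj : dist x q.1 ≤ δ := by
        have := mem_ball.1 ((ht q.1 q.2 q.2.2).2 (hhalf q.1 q.2 hq))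
        linarith
      have hf := hf₀box q.1 x hxj
      exact ⟨q.1, hxj, hf, (convex_Icc _ _).segment_subset hf (hΦ q x).1 (hgW q x hq)⟩
    · push Not at hx
      obtain ⟨j, hj, hxj⟩ := hcov x
      have hf := hf₀box ⟨j, hj⟩ x hxj
      exact ⟨⟨j, hj⟩, hxj, hf, by rwa [hgout x hx]⟩
  have hη : ∀ᶠ η : ℝ in 𝓝[>] 0, 3 * η < r ∧ ∀ i k l, k ≠ l → 5 * η < |c i k - c i l| := by
    have hlin : ∀ C : ℝ, Tendsto (fun η : ℝ => C * η) (𝓝[>] 0) (𝓝 0) := fun C => by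
      have : Tendsto (fun η : ℝ => C * η) (𝓝 0) (𝓝 (C * 0)) :=
        (continuous_const.mul continuous_id).tendsto 0
      rw [mul_zero] at this
      exact this.mono_left nhdsWithin_le_nhds
    refine ((hlin 3).eventually (gt_mem_nhds hr)).and ?_
    refine Filter.eventually_all.2 fun i => Filter.eventually_all.2 fun k =>
      Filter.eventually_all.2 fun l => ?_
    rcases eq_or_ne k l with hkl | hkl
    · exact Filter.Eventually.of_forall fun _ hne => absurd hkl hne
    · filter_upwards [(hlin 5).eventually
        (gt_mem_nhds (abs_pos.2 (sub_ne_zero.2 ((hcinj i).ne hkl))))] with η h _ using h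
  obtain ⟨η, ⟨hηr, hηsep⟩, hη0⟩ := (hη.and self_mem_nhdsWithin).exists
  refine ⟨g, lt_of_le_of_lt ((ContinuousMap.dist_le (by positivity)).2 fun x => ?_)
    (show 3 / 4 * ε < ε by linarith), η, hη0, fun f hf W y hy => ?_⟩
  · obtain ⟨j, -, hfj, hgj⟩ := hboth x
    refine (dist_pi_le_iff (by positivity)).2 fun i => abs_le.2 ⟨?_, ?_⟩ <;>
      linarith [hside j i, hfj.1 i, hfj.2 i, hgj.1 i, hgj.2 i]
  have hfg : ∀ x i, |f x i - g x i| ≤ η := fun x i =>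
    (dist_le_pi_dist (f x) (g x) i).trans ((ContinuousMap.dist_apply_le_dist x).trans hf.le)
  obtain ⟨j, ⟨w, hw, hwj⟩, hdeep⟩ := exists_deep_box c hη0 hηr hηsep
    {j : T | ∃ w ∈ W, dist w (j : K) ≤ δ} y (by
      intro z hz
      obtain ⟨w, hw, rfl⟩ := hy hz
      obtain ⟨j, hwj, -, hgj⟩ := hboth w
      refine ⟨j, ⟨w, hw, hwj⟩, fun i => ?_⟩
      have h1 := abs_le.1 (hfg w i)
      have h2 : c i (j, false) ≤ g w i := hgj.1 i
      have h3 : g w i ≤ c i (j, true) := hgj.2 i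
      exact ⟨by linarith, by linarith⟩)
  refine ⟨t j, e j, hsum j, hdisj j, fun p hp => ⟨(ht j p hp).1, he j, her j, fun x hx => ?_, ?_⟩⟩
  · have h1 := mem_ball.1 ((ht j p hp).2 hx)
    have h2 := dist_triangle_right x w j
    exact mem_thickening_iff.2 ⟨w, hw, by linarith⟩
  · refine mem_interior.2 ⟨Set.univ.pi fun i => Ioo (c i (j, false) + η) (c i (j, true) - η), ?_,
      isOpen_set_pi Set.finite_univ fun i _ => isOpen_Ioo, fun i _ => hdeep i⟩
    intro y' hy'
    obtain ⟨x, hx, h0⟩ := hφ ⟨j, p, hp⟩ (f - ContinuousMap.const K y') (by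
      intro x hx i
      have h1 := abs_le.1 (hfg x i)
      have h2 : c i (j, false) + η < y' i ∧ y' i < c i (j, true) - η := hy' i trivial
      rw [hgL _ x hx] at h1
      have h3 := (hΦ ⟨j, p, hp⟩ x).2 i
      change (_ → f x i - y' i < 0) ∧ (_ → 0 < f x i - y' i)
      refine ⟨fun h => ?_, fun h => ?_⟩
      · have h4 : _ = c i (j, false) := h3.1 h
        linarith
      · have h4 : _ = c i (j, true) := h3.2 h
        linarith)
    exact ⟨x, hLW ⟨j, p, hp⟩ hx, sub_eq_zero.1 h0⟩

/-- Points all of whose neighborhoods have `y` as an interior value. -/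
def stableFiber (f : C(K, Fin n → ℝ)) (y : Fin n → ℝ) : Set K :=
  {x | ∀ ε > 0, y ∈ interior (f '' ball x ε)}

theorem isClosed_stableFiber (f : C(K, Fin n → ℝ)) (y : Fin n → ℝ) :
    IsClosed (stableFiber f y) := by
  refine isClosed_of_closure_subset fun x hx ε hε => ?_
  obtain ⟨z, hz, hxz⟩ := Metric.mem_closure_iff.1 hx (ε / 2) (half_pos hε)
  refine interior_mono (Set.image_mono (ball_subset_ball' ?_)) (hz (ε / 2) (half_pos hε))
  rw [dist_comm]
  linarith

theorem stableFiber_subset (f : C(K, Fin n → ℝ)) (y : Fin n → ℝ) :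
    stableFiber f y ⊆ f ⁻¹' {y} := by
  intro x hx
  by_contra hne
  have hnhds : {z | f z ≠ y} ∈ 𝓝 x :=
    (isOpen_ne_fun f.continuous continuous_const).mem_nhds hne
  obtain ⟨ε, hε, hsub⟩ := Metric.mem_nhds_iff.1 hnhds
  obtain ⟨z, hz, hzy⟩ := interior_subset (hx ε hε)
  exact hsub hz hzy

theorem exists_one_div_small {f : C(K, Fin n → ℝ)} {W : Set K} {y : Fin n → ℝ}
    (hy : y ∈ interior (f '' W)) (M : ℕ) {δ : ℝ} (hδ : 0 < δ) :
    ∃ m : ℕ, M ≤ m ∧ (1 : ℝ) / (m + 1) < δ ∧ ball y (1 / (m + 1)) ⊆ f '' W := by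
  obtain ⟨ρ, hρ, hsub⟩ := Metric.mem_nhds_iff.1 (mem_interior_iff_mem_nhds.1 hy)
  have hev := (tendsto_one_div_add_atTop_nhds_zero_nat (𝕜 := ℝ)).eventually
    (gt_mem_nhds (lt_min hδ hρ))
  obtain ⟨m, hm, hMm⟩ := (hev.and (eventually_ge_atTop M)).exists
  exact ⟨m, hMm, hm.trans_le (min_le_left _ _),
    (ball_subset_ball (hm.le.trans (min_le_right _ _))).trans hsub⟩

theorem exists_mem_stableFiber [CompactSpace K]
    {f : C(K, Fin n → ℝ)} (hf : ∀ m, HasFiberPackings h m f)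
    {W : Set K} {y : Fin n → ℝ} (hy : y ∈ interior (f '' W)) :
    ∃ x ∈ closure W, x ∈ stableFiber f y := by
  have hex : ∀ k : ℕ, ∃ w, (∃ v ∈ W, dist w v < 1 / (k + 1)) ∧
      y ∈ interior (f '' ball w (1 / (k + 1))) := by
    intro k
    have hk : (0 : ℝ) < 1 / (k + 1) := by positivity
    obtain ⟨m, -, hm, hball⟩ := exists_one_div_small hy 0 hk
    obtain ⟨t, ε, hsum, -, ht⟩ := hf m W y hball
    obtain ⟨p, hp⟩ : t.Nonempty := by
      by_contra hempty
      simp [Finset.not_nonempty_iff_eq_empty.1 hempty] at hsum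
    obtain ⟨-, hε, hεm, hthick, hyp⟩ := ht p hp
    have hε' : (0 : ℝ) < ε := NNReal.coe_pos.2 hε
    obtain ⟨v, hv, hpv⟩ := mem_thickening_iff.1 (hthick (mem_ball_self hε'))
    exact ⟨p.1, ⟨v, hv, hpv.trans hm⟩,
      interior_mono (Set.image_mono (ball_subset_ball (by linarith))) hyp⟩
  choose w hw hyw using hex
  choose v hvW hwv using hw
  obtain ⟨x, φ, hφ, hx⟩ := CompactSpace.tendsto_subseq w
  have hlim : Tendsto (fun k => (1 : ℝ) / (φ k + 1)) atTop (𝓝 0) :=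
    (tendsto_one_div_add_atTop_nhds_zero_nat (𝕜 := ℝ)).comp hφ.tendsto_atTop
  have hclose : ∀ ε > 0, ∃ k, dist (w (φ k)) x < ε / 2 ∧ (1 : ℝ) / (φ k + 1) < ε / 2 :=
    fun ε hε => ((Metric.tendsto_nhds.1 hx _ (half_pos hε)).and
      (hlim.eventually (gt_mem_nhds (half_pos hε)))).exists
  refine ⟨x, Metric.mem_closure_iff.2 fun ε hε => ?_, fun ε hε => ?_⟩
  · obtain ⟨k, h1, h2⟩ := hclose ε hε
    have := dist_triangle_left x (v (φ k)) (w (φ k))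
    exact ⟨v (φ k), hvW _, by linarith [hwv (φ k)]⟩
  · obtain ⟨k, h1, h2⟩ := hclose ε hε
    exact interior_mono (Set.image_mono (ball_subset_ball' (by linarith))) (hyw (φ k))

theorem packPre0_inter_stableFiber [CompactSpace K]
    {f : C(K, Fin n → ℝ)} (hf : ∀ m, HasFiberPackings h m f)
    {y : Fin n → ℝ} {O : Set K} (hO : IsOpen O) (hne : (O ∩ stableFiber f y).Nonempty) :
    packPre0 h (O ∩ stableFiber f y) = ∞ := by
  obtain ⟨x, hxO, hx⟩ := hne
  obtain ⟨ρ, hρ, hsub⟩ := Metric.isOpen_iff.1 hO x hxO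
  refine iInf₂_eq_top.2 fun δ hδ => ENNReal.eq_top_of_forall_nnreal_le fun c => ?_
  obtain ⟨M, hM⟩ := exists_nat_ge c
  obtain ⟨m, hMm, hm, hball⟩ := exists_one_div_small (hx (ρ / 2) (half_pos hρ)) M
    (lt_min (half_pos hρ) (NNReal.coe_pos.2 hδ))
  obtain ⟨t, ε, hsum, hdisj, ht⟩ := hf m _ y hball
  have hex : ∀ p : K × ℝ≥0, ∃ z, p ∈ t → z ∈ O ∩ stableFiber f y ∧ dist z p.1 < ε := by
    intro p
    by_cases hp : p ∈ t
    · obtain ⟨-, hε, -, hthick, hyp⟩ := ht p hp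
      obtain ⟨z, hz, hzs⟩ := exists_mem_stableFiber hf hyp
      have hz' : dist z p.1 < ε :=
        (mem_closedBall.1 (closure_ball_subset_closedBall hz)).trans_lt
          (half_lt_self (NNReal.coe_pos.2 hε))
      refine ⟨z, fun _ => ⟨⟨hsub ?_, hzs⟩, hz'⟩⟩
      obtain ⟨w, hw, hzw⟩ := mem_thickening_iff.1 (hthick hz')
      rw [mem_ball] at hw ⊢
      linarith [dist_triangle z w x, min_le_left (ρ / 2) (δ : ℝ)]
    · exact ⟨x, fun hp' => absurd hp' hp⟩
  choose z hz using hex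
  calc (c : ℝ≥0∞) ≤ m := by
        have : c ≤ (m : ℝ≥0) := hM.trans (by exact_mod_cast hMm)
        exact_mod_cast this
    _ ≤ ∑ p ∈ t, (h (p.2 - ε) : ℝ≥0∞) := hsum.le
    _ ≤ packPre h (O ∩ stableFiber f y) δ :=
      sum_le_packPre h _ δ t z (fun p => p.2 - ε) (fun p hp => (hz p hp).1)
        (fun p hp => tsub_le_self.trans (NNReal.coe_le_coe.1
          ((ht p hp).1.trans (hm.le.trans (min_le_right _ _)))))
        fun p hp q hq hpq => hdisj p hp q hq hpq _ _ (hz p hp).2 (hz q hq).2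

theorem eventually_residual_hasFiberPackings [CompactSpace K]
    (hleft : ∀ r : ℝ≥0, Tendsto h (𝓝[<] r) (𝓝 (h r)))
    (hK : ∀ U : Set K, IsOpen U → U.Nonempty → (n : EReal) ≤ tdim U ∧ packMeasure h U = ∞) :
    ∀ᶠ f in residual C(K, Fin n → ℝ), ∀ m, HasFiberPackings h m f := by
  refine eventually_countable_forall.2 fun m => ?_
  refine mem_of_superset (residual_of_dense_open
    (isOpen_interior (s := {f : C(K, Fin n → ℝ) | HasFiberPackings h m f})) ?_) interior_subset
  refine Metric.dense_iff.2 fun f₀ ε hε => ?_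
  obtain ⟨g, hg, η, hη, hgη⟩ := exists_hasFiberPackings_near hleft hK m f₀ hε
  exact ⟨g, hg, mem_interior_iff_mem_nhds.2 (Metric.mem_nhds_iff.2 ⟨η, hη, fun f hf => hgη f hf⟩)⟩

end Generic

/-- Generic fibers have infinite (non-σ-finite) generalized packing measure. -/
theorem stmt7 (n : ℕ) (hn : 0 < n) (K : Type*) [MetricSpace K] [CompactSpace K]
    (h : ℝ≥0 → ℝ≥0) (hmono : Monotone h)
    (hleft : ∀ r : ℝ≥0, Filter.Tendsto h (nhdsWithin r (Set.Iio r)) (nhds (h r)))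
    (hK : ∀ U : Set K, IsOpen U → U.Nonempty →
      (n : EReal) ≤ tdim U ∧ packMeasure h U = ∞) :
    ∀ᶠ (f : C(K, Fin n → ℝ)) in residual C(K, Fin n → ℝ), ∀ y ∈ interior (Set.range ⇑f),
      packMeasure h (⇑f ⁻¹' {y}) = ∞ ∧ ¬ PackSigmaFiniteOn h (⇑f ⁻¹' {y}) := by
  filter_upwards [eventually_residual_hasFiberPackings hleft hK] with f hf y hy
  obtain ⟨x, -, hx⟩ := exists_mem_stableFiber hf (W := Set.univ) (by rwa [Set.image_univ])
  have hns : ¬ PackSigmaFiniteOn h (f ⁻¹' {y}) :=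
    not_packSigmaFiniteOn hleft (isClosed_stableFiber f y) ⟨x, hx⟩ (stableFiber_subset f y)
      fun O hO hne => packPre0_inter_stableFiber hf hO hne
  exact ⟨packMeasure_eq_top_of_not_packSigmaFiniteOn hns, hns⟩
end

section
/- Let n be a positive integer and let K be a compact metric space with dim_T K ≥ n. Then for a generic f ∈ C(K,ℝⁿ): (i) the fiber f⁻¹(y) has at most n points for every y in the boundary of f(K); (ii) the fiber f⁻¹(y) has cardinality 2^{ℵ₀} for every y in the interior of f(K). -/
open Set Metric Filter Topology TopologicalSpace
open scoped ENNReal NNReal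

section StableValues

variable {K E : Type*} [MetricSpace K] [CompactSpace K] [NormedAddCommGroup E]

/-- Every `ε`-perturbation of `f` takes the value `y` on `C`. -/
def IsStableWithin (ε : ℝ) (C : Set K) (f : C(K, E)) (y : E) : Prop :=
  ∀ g : C(K, E), dist g f < ε → y ∈ g '' C

/-- Every sufficiently small perturbation of `f` takes the value `y` on `C`. -/
def IsStableValue (C : Set K) (f : C(K, E)) (y : E) : Prop :=
  ∃ ε > 0, IsStableWithin ε C f y

lemma IsStableWithin.mem_image {ε : ℝ} {C : Set K} {f : C(K, E)} {y : E}
    (h : IsStableWithin ε C f y) (hε : 0 < ε) : y ∈ f '' C :=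
  h f (by simpa using hε)

lemma IsStableValue.mem_image {C : Set K} {f : C(K, E)} {y : E} (h : IsStableValue C f y) :
    y ∈ f '' C := by
  obtain ⟨ε, hε, h⟩ := h
  exact h.mem_image hε

lemma IsStableValue.mono {C D : Set K} {f : C(K, E)} {y : E} (h : IsStableValue C f y)
    (hCD : C ⊆ D) : IsStableValue D f y := by
  obtain ⟨ε, hε, h⟩ := h
  exact ⟨ε, hε, fun g hg => image_mono hCD (h g hg)⟩

/-- Stability on `C` depends only on the restriction to `C`. -/
lemma IsStableValue.congr {C : Set K} {f g : C(K, E)} {y : E} (h : IsStableValue C f y)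
    (hfg : EqOn f g C) : IsStableValue C g y := by
  obtain ⟨ε, hε, h⟩ := h
  refine ⟨ε, hε, fun k hk => ?_⟩
  obtain ⟨x, hx, hxy⟩ := h (k + (f - g)) (by
    rw [dist_eq_norm] at hk ⊢
    convert hk using 2
    abel)
  refine ⟨x, hx, ?_⟩
  simpa [hfg hx] using hxy

/-- Stability of `y` depends only on the points that are sent close to `y`. -/
lemma IsStableValue.inter_preimage {C : Set K} {f : C(K, E)} {y : E} {N : Set E}
    (h : IsStableValue C f y) (hN : N ∈ 𝓝 y) : IsStableValue (C ∩ f ⁻¹' N) f y := by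
  obtain ⟨ε, hε, h⟩ := h
  obtain ⟨r, hr, hrN⟩ := Metric.mem_nhds_iff.1 hN
  refine ⟨min ε r, lt_min hε hr, fun g hg => ?_⟩
  obtain ⟨x, hx, rfl⟩ := h g (hg.trans_le (min_le_left _ _))
  refine ⟨x, ⟨hx, hrN ?_⟩, rfl⟩
  rw [Metric.mem_ball, dist_comm]
  exact (ContinuousMap.dist_apply_le_dist x).trans_lt (hg.trans_le (min_le_right _ _))

lemma IsStableWithin.of_dist {ε δ : ℝ} {C : Set K} {f g : C(K, E)} {y z : E}
    (h : IsStableWithin ε C f y) (hδ : δ + dist f g + dist y z ≤ ε) :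
    IsStableWithin δ C g z := by
  intro k hk
  obtain ⟨x, hx, hxy⟩ := h (k + ContinuousMap.const K (y - z)) (by
    have h1 : dist (k + ContinuousMap.const K (y - z)) k ≤ dist y z := by
      rw [ContinuousMap.dist_le dist_nonneg]
      intro x
      simp [dist_eq_norm]
    have h2 := dist_triangle (k + ContinuousMap.const K (y - z)) k f
    have h3 := dist_triangle k g f
    rw [dist_comm g f] at h3
    linarith)
  refine ⟨x, hx, ?_⟩
  have : k x + (y - z) = y := by simpa using hxy
  rw [← sub_eq_zero] at this ⊢
  rw [← this]
  abel

lemma isOpen_setOf_isStableValue (C : Set K) :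
    IsOpen {p : C(K, E) × E | IsStableValue C p.1 p.2} := by
  rw [Metric.isOpen_iff]
  rintro ⟨f, y⟩ ⟨ε, hε, h⟩
  refine ⟨ε / 3, by positivity, ?_⟩
  rintro ⟨g, z⟩ hgz
  rw [Metric.mem_ball, Prod.dist_eq, max_lt_iff] at hgz
  refine ⟨ε / 3, by positivity, h.of_dist ?_⟩
  have h1 : dist f g < ε / 3 := by rw [dist_comm]; exact hgz.1
  have h2 : dist y z < ε / 3 := by rw [dist_comm]; exact hgz.2
  linarith

lemma IsStableValue.mem_interior_range {C : Set K} {f : C(K, E)} {y : E}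
    (h : IsStableValue C f y) : y ∈ interior (range f) := by
  have ho : IsOpen {z | IsStableValue C f z} :=
    (isOpen_setOf_isStableValue C).preimage (Continuous.prodMk_right f)
  exact interior_maximal (fun z hz => image_subset_range _ _ hz.mem_image) ho h

lemma isClosed_setOf_apply_mem_image {C : Set K} (hC : IsClosed C) :
    IsClosed {p : C(K, E) × K | p.1 p.2 ∈ p.1 '' C} := by
  have h : IsClosed {q : (C(K, E) × K) × K | q.2 ∈ C ∧ q.1.1 q.2 = q.1.1 q.1.2} :=
    (hC.preimage continuous_snd).inter (isClosed_eq (by fun_prop) (by fun_prop))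
  convert isClosedMap_fst_of_compactSpace _ h using 1
  ext ⟨f, x⟩
  simp

lemma isOpen_setOf_forall_isStableValue {C : Set K} {D : Set E} (hD : IsClosed D) :
    IsOpen {f : C(K, E) | ∀ x, f x ∈ D → IsStableValue C f (f x)} := by
  have h : IsClosed {p : C(K, E) × K | p.1 p.2 ∈ D ∧ ¬ IsStableValue C p.1 (p.1 p.2)} :=
    (hD.preimage (by fun_prop)).inter
      ((isOpen_setOf_isStableValue C).isClosed_compl.preimage
        (f := fun p : C(K, E) × K => (p.1, p.1 p.2)) (by fun_prop))
  rw [← isClosed_compl_iff]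
  convert isClosedMap_fst_of_compactSpace _ h using 1
  ext f
  simp

lemma isOpen_setOf_notMem_range (y : E) : IsOpen {f : C(K, E) | y ∉ range f} := by
  have h : IsClosed {p : C(K, E) × K | p.1 p.2 = y} :=
    isClosed_eq (by fun_prop) (by fun_prop)
  rw [← isClosed_compl_iff]
  convert isClosedMap_fst_of_compactSpace _ h using 1
  ext f
  simp

/-- Generically, all interior values of the image are stable. -/
lemma eventually_residual_interior_isStableValue [SecondCountableTopology E] :
    ∀ᶠ f : C(K, E) in residual C(K, E),
      ∀ y ∈ interior (range f), IsStableValue univ f y := by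
  have key : ∀ V ∈ countableBasis E, ∀ᶠ f : C(K, E) in residual C(K, E),
      (∀ x, f x ∈ closure V → IsStableValue univ f (f x)) ∨ ∃ y ∈ closure V, y ∉ range f := by
    intro V _
    refine residual_of_dense_open ?_ ?_
    · have h : IsOpen (⋃ y ∈ closure V, {f : C(K, E) | y ∉ range f}) :=
        isOpen_biUnion fun y _ => isOpen_setOf_notMem_range y
      convert (isOpen_setOf_forall_isStableValue (C := univ) (isClosed_closure (s := V))).union h using 1
      ext f
      simp
    · rw [Metric.dense_iff]
      intro f r hr
      by_cases h : ∀ x, f x ∈ closure V → IsStableValue univ f (f x)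
      · exact ⟨f, mem_ball_self hr, Or.inl h⟩
      · push Not at h
        obtain ⟨x, hx, hns⟩ := h
        simp only [IsStableValue, IsStableWithin, not_exists, not_and, not_forall] at hns
        obtain ⟨g, hg, hgx⟩ := hns r hr
        exact ⟨g, hg, Or.inr ⟨f x, hx, by simpa using hgx⟩⟩
  filter_upwards [(eventually_countable_ball (countable_countableBasis E)).2 key] with f hf y hy
  obtain ⟨V, hV, hyV, hVs⟩ := (isBasis_countableBasis E).exists_closure_subset
    (isOpen_interior.mem_nhds hy)
  obtain h | ⟨z, hz, hzn⟩ := hf V hV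
  · obtain ⟨x, rfl⟩ := interior_subset hy
    exact h x (subset_closure hyV)
  · exact absurd (interior_subset (hVs hz)) hzn

end StableValues

section Push

variable {E : Type*} [NormedAddCommGroup E] [NormedSpace ℝ E]

/-- A continuous map fixing the complement of an open convex set `V` that pushes all points of `V`
outside a small neighbourhood of `y ∈ V` to the boundary of `V`. -/
lemma exists_continuous_push {V : Set E} (hVo : IsOpen V) (hVc : Convex ℝ V)
    (hVb : Bornology.IsBounded V) {y : E} (hy : y ∈ V)
    {T : Set E} (hT : IsCompact T) (hyT : y ∉ T) :
    ∃ r : E → E, Continuous r ∧ (∀ z ∉ V, r z = z) ∧ (∀ z ∈ V, r z ∈ closure V) ∧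
      ∀ z ∈ T, r z ∉ V := by
  set W : Set E := (fun w => y + w) ⁻¹' V with hW
  have hWo : IsOpen W := hVo.preimage (by fun_prop)
  have hWc : Convex ℝ W := hVc.translate_preimage_right y
  have hW0 : W ∈ 𝓝 (0 : E) := hWo.mem_nhds (by simpa [hW] using hy)
  have hcont : Continuous (gauge W) := continuous_gauge hWc hW0
  have hlt (w : E) : gauge W w < 1 ↔ y + w ∈ V := by
    rw [gauge_lt_one_iff_mem_interior hWc hW0, hWo.interior_eq, hW, mem_preimage]
  have hle (w : E) : gauge W w ≤ 1 ↔ y + w ∈ closure V := by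
    rw [gauge_le_one_iff_mem_closure hWc hW0, hW, ← Homeomorph.coe_addLeft,
      ← Homeomorph.preimage_closure, mem_preimage]
    rfl
  have hpos (z : E) (hz : z ∈ T) : 0 < gauge W (z - y) := by
    refine (gauge_pos (absorbent_nhds_zero hW0) (NormedSpace.isVonNBounded_iff ℝ |>.2 ?_)).2
      (sub_ne_zero.2 fun h => hyT (h ▸ hz))
    obtain ⟨R, hR⟩ := hVb.exists_norm_le
    refine isBounded_iff_forall_norm_le.2 ⟨R + ‖y‖, fun w hw => ?_⟩
    have := norm_sub_le (y + w) y
    rw [add_sub_cancel_left] at this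
    linarith [hR _ hw]
  obtain ⟨δ, hδ, hδT⟩ := hT.exists_forall_le' (f := fun z => gauge W (z - y))
    (by fun_prop) hpos
  set c : E → ℝ := fun z => min 1 (max (gauge W (z - y)) δ) with hc
  have hc0 (z : E) : 0 < c z := lt_min one_pos (lt_max_of_lt_right hδ)
  have hgauge (z : E) : gauge W ((c z)⁻¹ • (z - y)) = (c z)⁻¹ * gauge W (z - y) :=
    gauge_smul_of_nonneg (inv_nonneg.2 (hc0 z).le) _
  have hV (z : E) : gauge W (z - y) < 1 ↔ z ∈ V := by rw [hlt, add_sub_cancel]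
  refine ⟨fun z => y + (c z)⁻¹ • (z - y), ?_, fun z hz => ?_, fun z hz => ?_, fun z hz => ?_⟩
  · have : Continuous c := by fun_prop
    have := this.inv₀ fun z => (hc0 z).ne'
    exact continuous_const.add (this.smul (continuous_id.sub continuous_const))
  · rw [← hV, not_lt] at hz
    have : c z = 1 := min_eq_left (le_max_of_le_left hz)
    simp [this]
  · rw [← hV] at hz
    rw [← hle, hgauge, inv_mul_le_one₀ (hc0 z)]
    exact le_min hz.le (le_max_left _ _)
  · rw [← hlt, hgauge, not_lt, one_le_inv_mul₀ (hc0 z)]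
    exact (min_le_right _ _).trans (max_le le_rfl (hδT z hz))

variable {K : Type*} [MetricSpace K] [CompactSpace K]

/-- If `y ∈ V` is not stable, then `f` can be perturbed inside `V` only, so as to miss `y`. -/
lemma exists_perturbation_notMem_image {B : Set K} {f : C(K, E)} {V : Set E} (hVo : IsOpen V)
    {y : E} (hy : y ∈ V) (hns : ¬ IsStableValue B f y) :
    ∃ g : C(K, E), (∀ x, f x ∉ V → g x = f x) ∧ (∀ x, f x ∈ V → g x ∈ V) ∧ y ∉ g '' B := by
  obtain ⟨R, hR, hRV⟩ := Metric.isOpen_iff.1 hVo y hy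
  set ρ := R / 3 with hρ
  have hρ0 : 0 < ρ := by positivity
  simp only [IsStableValue, IsStableWithin, not_exists, not_and, not_forall] at hns
  obtain ⟨h, hhf, hyh⟩ := hns ρ hρ0
  set l : K → ℝ := fun x => max 0 (min 1 (2 - dist (f x) y / ρ)) with hl
  have hl0 (x : K) : 0 ≤ l x := le_max_left _ _
  have hl1 (x : K) : l x ≤ 1 := max_le zero_le_one (min_le_left _ _)
  have hlc : Continuous l := by fun_prop
  have hhx (x : K) : ‖h x - f x‖ < ρ := by
    rw [← dist_eq_norm]
    exact (ContinuousMap.dist_apply_le_dist x).trans_lt hhf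
  have hlh (x : K) : ‖l x • (h x - f x)‖ < ρ := by
    rw [norm_smul, Real.norm_of_nonneg (hl0 x)]
    exact (mul_le_of_le_one_left (norm_nonneg _) (hl1 x)).trans_lt (hhx x)
  have hl_far (x : K) (hx : 2 * ρ ≤ dist (f x) y) : l x = 0 := by
    have : 2 ≤ dist (f x) y / ρ := by rwa [le_div_iff₀ hρ0]
    exact max_eq_left ((min_le_right _ _).trans (by linarith))
  have hl_near (x : K) (hx : dist (f x) y ≤ ρ) : l x = 1 := by
    have : dist (f x) y / ρ ≤ 1 := by rwa [div_le_one hρ0]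
    rw [hl]
    simp only
    rw [min_eq_left (by linarith), max_eq_right zero_le_one]
  refine ⟨⟨fun x => f x + l x • (h x - f x), by fun_prop⟩, fun x hx => ?_, fun x hx => ?_, ?_⟩
  · have : 2 * ρ ≤ dist (f x) y := by
      by_contra! hlt
      exact hx (hRV (Metric.mem_ball.2 (by linarith)))
    simp [hl_far x this]
  · by_cases hfar : 2 * ρ ≤ dist (f x) y
    · simpa [hl_far x hfar] using hx
    · apply hRV
      simp only [ContinuousMap.coe_mk, Metric.mem_ball]
      have h1 := dist_triangle (f x + l x • (h x - f x)) (f x) y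
      rw [dist_self_add_left] at h1
      linarith [hlh x]
  · rintro ⟨x, hx, hxy⟩
    simp only [ContinuousMap.coe_mk] at hxy
    by_cases hnear : dist (f x) y ≤ ρ
    · rw [hl_near x hnear, one_smul, add_sub_cancel] at hxy
      exact hyh ⟨x, hx, hxy⟩
    · refine hnear ?_
      rw [← hxy, dist_self_add_right]
      exact (hlh x).le

/-- If some `y ∈ V` is not stable for `f` on `B`, then `f` can be modified inside `V` only,
so as to miss `V` on `B`. -/
lemma exists_perturbation_disjoint {B : Set K} (hB : IsClosed B) {f : C(K, E)} {V : Set E}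
    (hVo : IsOpen V) (hVc : Convex ℝ V) (hVb : Bornology.IsBounded V) {y : E} (hy : y ∈ V)
    (hns : ¬ IsStableValue B f y) :
    ∃ g : C(K, E), (∀ x, f x ∉ V → g x = f x) ∧ (∀ x, f x ∈ V → g x ∈ closure V) ∧
      ∀ x ∈ B, g x ∉ V := by
  obtain ⟨h, hfix, hmap, hyh⟩ := exists_perturbation_notMem_image hVo hy hns
  obtain ⟨r, hrc, hr1, hr2, hr3⟩ :=
    exists_continuous_push hVo hVc hVb hy (hB.isCompact.image h.continuous) hyh
  refine ⟨⟨fun x => r (h x), by fun_prop⟩, fun x hx => ?_, fun x hx => hr2 _ (hmap x hx),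
    fun x hx => hr3 _ (mem_image_of_mem _ hx)⟩
  have := hfix x hx
  simp only [ContinuousMap.coe_mk]
  rw [this, hr1 _ hx]

/-- Given finitely many pairwise disjoint bounded open convex sets, `f` can be modified inside them
so that all values on `B` in these sets become stable. -/
lemma exists_perturbation_isStableValue {ι : Type*} (A : Finset ι) {V : ι → Set E}
    (hVo : ∀ i, IsOpen (V i)) (hVc : ∀ i, Convex ℝ (V i))
    (hVb : ∀ i, Bornology.IsBounded (V i)) (hVd : Pairwise (Function.onFun Disjoint V))
    {B : Set K} (hB : IsClosed B) (f : C(K, E)) :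
    ∃ g : C(K, E), (∀ x, g x = f x ∨ ∃ i ∈ A, f x ∈ V i ∧ g x ∈ closure (V i)) ∧
      ∀ i ∈ A, ∀ y ∈ V i, y ∈ g '' B → IsStableValue B g y := by
  classical
  induction A using Finset.induction_on with
  | empty => exact ⟨f, by simp⟩
  | insert i A hi ih =>
    obtain ⟨g, hg1, hg2⟩ := ih
    by_cases hst : ∀ y ∈ V i, y ∈ g '' B → IsStableValue B g y
    · refine ⟨g, fun x => (hg1 x).imp_right fun ⟨j, hj, h⟩ => ⟨j, Finset.mem_insert_of_mem hj, h⟩,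
        fun j hj => ?_⟩
      obtain rfl | hj := Finset.mem_insert.1 hj
      · exact hst
      · exact hg2 j hj
    push Not at hst
    obtain ⟨y, hy, -, hns⟩ := hst
    obtain ⟨h, hfix, hmap, hmiss⟩ :=
      exists_perturbation_disjoint hB (hVo i) (hVc i) (hVb i) hy hns
    have hdisj {j : ι} (hj : j ≠ i) : Disjoint (V j) (closure (V i)) :=
      (hVd hj).closure_right (hVo j)
    refine ⟨h, fun x => ?_, fun j hj y hyj hyB => ?_⟩
    · by_cases hx : g x ∈ V i
      · refine Or.inr ⟨i, Finset.mem_insert_self _ _, ?_, hmap x hx⟩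
        obtain hgf | ⟨j, hj, -, hxj⟩ := hg1 x
        · rwa [← hgf]
        · have hji : i ≠ j := by rintro rfl; exact hi hj
          exact (((hVd hji).closure_right (hVo i)).ne_of_mem hx hxj rfl).elim
      · rw [hfix x hx]
        exact (hg1 x).imp_right fun ⟨j, hj, h⟩ => ⟨j, Finset.mem_insert_of_mem hj, h⟩
    · obtain rfl | hjA := Finset.mem_insert.1 hj
      · obtain ⟨x, hx, rfl⟩ := hyB
        exact absurd hyj (hmiss x hx)
      · have hji : j ≠ i := by rintro rfl; exact hi hjA
        have hgh {x : K} (hx : h x ∈ V j) : g x = h x := by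
          refine (hfix x fun hxi => ?_).symm
          exact (hdisj hji).ne_of_mem hx (hmap x hxi) rfl
        have hgB : y ∈ g '' B := by
          obtain ⟨x, hx, rfl⟩ := hyB
          exact ⟨x, hx, hgh hyj⟩
        refine (((hg2 j hjA y hyj hgB).inter_preimage ((hVo j).mem_nhds hyj)).congr ?_).mono
          inter_subset_left
        intro x hx
        exact (hfix x fun hxi => (hVd hji).ne_of_mem hx.2 hxi rfl).symm

end Push

section Grid

variable {K : Type*} [MetricSpace K] [CompactSpace K] {n : ℕ}

/-- After a small perturbation, the unstable values on `B` lie on a grid of hyperplanes. -/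
lemma exists_dist_le_isStableValue_off_grid {B : Set K} (hB : IsClosed B)
    (f : C(K, Fin n → ℝ)) {s : ℝ} (hs : 0 < s) (a : ℝ) :
    ∃ g : C(K, Fin n → ℝ), dist g f ≤ s ∧
      ∀ y ∈ g '' B, (∀ (j : Fin n) (k : ℤ), y j ≠ s * (k + a)) → IsStableValue B g y := by
  set V : (Fin n → ℤ) → Set (Fin n → ℝ) :=
    fun k => univ.pi fun j => Ioo (s * (k j + a)) (s * (k j + a + 1)) with hV
  have hcl (k : Fin n → ℤ) :
      closure (V k) ⊆ univ.pi fun j => Icc (s * (k j + a)) (s * (k j + a + 1)) :=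
    closure_minimal (pi_mono fun j _ => Ioo_subset_Icc_self)
      (isClosed_set_pi fun j _ => isClosed_Icc)
  have hVo (k) : IsOpen (V k) := isOpen_set_pi finite_univ fun j _ => isOpen_Ioo
  have hVc (k) : Convex ℝ (V k) := convex_pi fun j _ => convex_Ioo _ _
  have hVb (k) : Bornology.IsBounded (V k) := Bornology.IsBounded.pi fun j => isBounded_Ioo _ _
  have hVd : Pairwise (Function.onFun Disjoint V) := by
    intro k l hkl
    refine Set.disjoint_left.2 fun y hk hl => hkl (funext fun j => ?_)
    obtain ⟨h1, h2⟩ := hk j (mem_univ j)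
    obtain ⟨h3, h4⟩ := hl j (mem_univ j)
    have h5 : (k j : ℝ) + a < l j + a + 1 := lt_of_mul_lt_mul_left (h1.trans h4) hs.le
    have h6 : (l j : ℝ) + a < k j + a + 1 := lt_of_mul_lt_mul_left (h3.trans h2) hs.le
    have h7 : (k j : ℝ) < l j + 1 := by linarith
    have h8 : (l j : ℝ) < k j + 1 := by linarith
    norm_cast at h7 h8
    omega
  obtain ⟨N, hN⟩ := exists_nat_ge ((‖f‖ + s) / s + |a| + 1)
  obtain ⟨g, hg1, hg2⟩ := exists_perturbation_isStableValue
    (Fintype.piFinset fun _ : Fin n => Finset.Icc (-N : ℤ) N) hVo hVc hVb hVd hB f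
  have hgf : dist g f ≤ s := by
    refine (ContinuousMap.dist_le hs.le).2 fun x => ?_
    obtain h | ⟨k, -, hk, hk'⟩ := hg1 x
    · simp [h, hs.le]
    · refine (dist_pi_le_iff hs.le).2 fun j => ?_
      obtain ⟨h1, h2⟩ := hk j (mem_univ j)
      obtain ⟨h3, h4⟩ := hcl k hk' j (mem_univ j)
      rw [Real.dist_eq, abs_le]
      constructor <;> linarith
  refine ⟨g, hgf, ?_⟩
  rintro _ ⟨x, hx, rfl⟩ hoff
  set k : Fin n → ℤ := fun j => ⌊g x j / s - a⌋ with hk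
  have hmem : g x ∈ V k := by
    intro j _
    have h1 : (k j : ℝ) ≤ g x j / s - a := Int.floor_le _
    have h2 : g x j / s - a < k j + 1 := Int.lt_floor_add_one _
    have h3 : s * (k j + a) ≤ g x j := by
      rw [mul_comm, ← le_div_iff₀ hs]; linarith
    have h4 : g x j < s * (k j + a + 1) := by
      rw [mul_comm, ← div_lt_iff₀ hs]; linarith
    exact ⟨lt_of_le_of_ne h3 (hoff j (k j)).symm, h4⟩
  refine hg2 k ?_ _ hmem ⟨x, hx, rfl⟩
  rw [Fintype.mem_piFinset]
  intro j
  obtain ⟨h1, h2⟩ := hmem j (mem_univ j)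
  have h3 : |g x j| ≤ ‖f‖ + s := by
    have h4 : dist (g x) (f x) ≤ s := (ContinuousMap.dist_apply_le_dist x).trans hgf
    rw [dist_eq_norm] at h4
    have h5 : ‖g x‖ ≤ ‖f x‖ + ‖g x - f x‖ := by
      simpa using norm_add_le (f x) (g x - f x)
    have h6 := norm_le_pi_norm (g x) j
    rw [Real.norm_eq_abs] at h6
    linarith [f.norm_coe_le_norm x]
  have h7 : s * ((‖f‖ + s) / s) = ‖f‖ + s := mul_div_cancel₀ _ hs.ne'
  have h8 := abs_le.1 h3
  have h9 := neg_abs_le a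
  have h10 := le_abs_self a
  have h11 : (k j : ℝ) + a ≤ (‖f‖ + s) / s :=
    le_of_mul_le_mul_left (by linarith) hs
  have h12 : -((‖f‖ + s) / s) ≤ k j + a + 1 :=
    le_of_mul_le_mul_left (by linarith) hs
  rw [Finset.mem_Icc]
  constructor
  · have : (-N : ℝ) ≤ k j := by linarith
    exact_mod_cast this
  · have : (k j : ℝ) ≤ N := by linarith
    exact_mod_cast this

omit [CompactSpace K] in
lemma exists_continuous_eqOn_of_pairwise_disjoint {ι : Type*} [Finite ι] {B : ι → Set K}
    (hB : ∀ i, IsClosed (B i)) (hd : Pairwise (Function.onFun Disjoint B)) (i : ι) :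
    ∃ φ : C(K, ℝ), EqOn φ 1 (B i) ∧ (∀ j ≠ i, EqOn φ 0 (B j)) ∧ ∀ x, φ x ∈ Icc (0 : ℝ) 1 := by
  obtain ⟨φ, h0, h1, h⟩ := exists_continuous_zero_one_of_isClosed
    (s := ⋃ j : {j // j ≠ i}, B j) (t := B i) (isClosed_iUnion_of_finite fun j => hB j) (hB i)
    (disjoint_iUnion_left.2 fun j => hd j.2)
  exact ⟨φ, h1, fun j hj x hx => h0 (mem_iUnion.2 ⟨⟨j, hj⟩, hx⟩), h⟩

/-- Perturbations on pairwise disjoint closed sets can be glued. -/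
lemma exists_dist_lt_forall_eqOn {E : Type*} [NormedAddCommGroup E] [NormedSpace ℝ E]
    {ι : Type*} [Fintype ι] {B : ι → Set K}
    (hB : ∀ i, IsClosed (B i)) (hd : Pairwise (Function.onFun Disjoint B))
    (f : C(K, E)) {ε : ℝ} (hε : 0 < ε) :
    ∃ δ > 0, ∀ g : ι → C(K, E), (∀ i, dist (g i) f ≤ δ) →
      ∃ h : C(K, E), dist h f < ε ∧ ∀ i, EqOn h (g i) (B i) := by
  classical
  choose φ h1 h0 h01 using exists_continuous_eqOn_of_pairwise_disjoint hB hd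
  have hc : (0 : ℝ) < Fintype.card ι + 1 := by positivity
  refine ⟨ε / (Fintype.card ι + 1), by positivity, fun g hg => ?_⟩
  refine ⟨⟨fun x => f x + ∑ i, φ i x • (g i x - f x), by fun_prop⟩, ?_, fun i x hx => ?_⟩
  · refine (ContinuousMap.dist_lt_iff hε).2 fun x => ?_
    simp only [ContinuousMap.coe_mk, dist_self_add_left]
    have hle : ‖∑ i, φ i x • (g i x - f x)‖ ≤ ∑ _i : ι, ε / (Fintype.card ι + 1) := by
      refine norm_sum_le_of_le _ fun i _ => ?_
      rw [norm_smul, Real.norm_of_nonneg (h01 i x).1, ← dist_eq_norm]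
      exact (mul_le_of_le_one_left dist_nonneg (h01 i x).2).trans
        ((ContinuousMap.dist_apply_le_dist x).trans (hg i))
    refine hle.trans_lt ?_
    rw [Finset.sum_const, Finset.card_univ, nsmul_eq_mul, mul_div_assoc', div_lt_iff₀ hc]
    linarith
  · simp only [ContinuousMap.coe_mk]
    rw [Finset.sum_eq_single i]
    · simp [h1 i hx]
    · intro j _ hj
      simp [h0 j i hj.symm hx]
    · simp

lemma eventually_residual_exists_isStableValue {B : Fin (n + 1) → Set K}
    (hB : ∀ i, IsClosed (B i)) (hd : Pairwise (Function.onFun Disjoint B)) :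
    ∀ᶠ f : C(K, Fin n → ℝ) in residual C(K, Fin n → ℝ),
      ∀ x, (∀ i, f x ∈ f '' B i) → ∃ i, IsStableValue (B i) f (f x) := by
  refine residual_of_dense_open ?_ ?_
  · have h : IsClosed {p : C(K, Fin n → ℝ) × K |
        ∀ i, p.1 p.2 ∈ p.1 '' B i ∧ ¬ IsStableValue (B i) p.1 (p.1 p.2)} := by
      simp only [ofPred_forall]
      refine isClosed_iInter fun i => (isClosed_setOf_apply_mem_image (hB i)).inter
        ((isOpen_setOf_isStableValue (B i)).isClosed_compl.preimage
        (f := fun p : C(K, Fin n → ℝ) × K => (p.1, p.1 p.2)) (by fun_prop))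
    rw [← isClosed_compl_iff]
    convert isClosedMap_fst_of_compactSpace _ h using 1
    ext f
    simp [forall_and]
  · rw [Metric.dense_iff]
    intro f r hr
    obtain ⟨δ, hδ, hglue⟩ := exists_dist_lt_forall_eqOn hB hd f hr
    choose g hgf hg using fun i : Fin (n + 1) =>
      exists_dist_le_isStableValue_off_grid (hB i) f hδ (i / (n + 1) : ℝ)
    obtain ⟨h, hhf, hhg⟩ := hglue g hgf
    refine ⟨h, hhf, fun x hx => ?_⟩
    by_contra! hns
    have hgrid (i : Fin (n + 1)) :
        ∃ (j : Fin n) (k : ℤ), h x j = δ * (k + (i / (n + 1) : ℝ)) := by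
      by_contra! hoff
      refine hns i ((hg i (h x) ?_ hoff).congr (hhg i).symm)
      exact (hhg i).image_eq ▸ hx i
    choose j k hjk using hgrid
    obtain ⟨i, i', hne, hij⟩ := Fintype.exists_ne_map_eq_of_card_lt j (by simp)
    have h1 := hjk i
    rw [hij, hjk i'] at h1
    have h2 := mul_left_cancel₀ hδ.ne' h1
    have hn : (n + 1 : ℝ) ≠ 0 := by positivity
    field_simp at h2
    norm_cast at h2
    have h3 := i.2
    have h4 := i'.2
    refine hne (Fin.ext ?_)
    have h5 : k i = k i' := by
      by_contra hk
      rcases lt_or_gt_of_ne hk with hk | hk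
      · have : ((n + 1 : ℕ) : ℤ) * (k i + 1) ≤ (n + 1 : ℕ) * k i' := by gcongr; omega
        push_cast at *
        nlinarith
      · have : ((n + 1 : ℕ) : ℤ) * (k i' + 1) ≤ (n + 1 : ℕ) * k i := by gcongr; omega
        push_cast at *
        nlinarith
    rw [h5] at h2
    push_cast at h2
    have h6 : (i : ℤ) = i' := by linarith
    exact_mod_cast h6

end Grid

section Splitting

variable {K : Type*} [MetricSpace K] [CompactSpace K] {n : ℕ}

variable (K) in
lemma exists_countable_closed_family :
    ∃ 𝓒 : Set (Set K), 𝓒.Countable ∧ (∀ C ∈ 𝓒, IsClosed C) ∧ univ ∈ 𝓒 ∧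
      (∀ C ∈ 𝓒, ∀ D ∈ 𝓒, C ∩ D ∈ 𝓒) ∧
      ∀ F W : Set K, IsClosed F → IsOpen W → F ⊆ W → ∃ C ∈ 𝓒, F ⊆ C ∧ C ⊆ W := by
  have : SecondCountableTopology K := EMetric.secondCountable_of_sigmaCompact K
  refine ⟨(fun s : Set (Set K) => (⋃₀ s)ᶜ) '' {s | s.Finite ∧ s ⊆ countableBasis K},
    (countable_ofPred_finite_subset (countable_countableBasis K)).image _, ?_, ?_, ?_, ?_⟩
  · rintro _ ⟨s, ⟨-, hs⟩, rfl⟩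
    exact (isOpen_sUnion fun U hU => isOpen_of_mem_countableBasis (hs hU)).isClosed_compl
  · exact ⟨∅, by simp⟩
  · rintro _ ⟨s, ⟨hs, hs'⟩, rfl⟩ _ ⟨t, ⟨ht, ht'⟩, rfl⟩
    exact ⟨s ∪ t, ⟨hs.union ht, union_subset hs' ht'⟩, by simp [sUnion_union]⟩
  · intro F W hF hW hFW
    have hcov : Wᶜ ⊆ ⋃ U : {U // U ∈ countableBasis K ∧ U ⊆ Fᶜ}, (U : Set K) := by
      intro x hx
      obtain ⟨U, hU, hxU, hUF⟩ := (isBasis_countableBasis K).exists_subset_of_mem_open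
        (show x ∈ Fᶜ from fun h => hx (hFW h)) hF.isOpen_compl
      exact mem_iUnion.2 ⟨⟨U, hU, hUF⟩, hxU⟩
    obtain ⟨t, ht⟩ := hW.isClosed_compl.isCompact.elim_finite_subcover _
      (fun U => isOpen_of_mem_countableBasis U.2.1) hcov
    refine ⟨_, ⟨Subtype.val '' (t : Set {U // U ∈ countableBasis K ∧ U ⊆ Fᶜ}),
      ⟨t.finite_toSet.image _, ?_⟩, rfl⟩, ?_, ?_⟩
    · rintro _ ⟨U, -, rfl⟩
      exact U.2.1
    · rw [subset_compl_comm]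
      refine sUnion_subset ?_
      rintro _ ⟨U, -, rfl⟩
      exact U.2.2
    · rw [compl_subset_comm]
      refine ht.trans (iUnion₂_subset fun U hU => ?_)
      exact subset_sUnion_of_mem ⟨U, hU, rfl⟩

/-- The value `y` is stable for `f` on two disjoint members of `𝓒` contained in `C`. -/
def SplitsStably (𝓒 : Set (Set K)) (C : Set K) (f : C(K, Fin n → ℝ)) (y : Fin n → ℝ) : Prop :=
  ∃ C₀ ∈ 𝓒, ∃ C₁ ∈ 𝓒, C₀ ⊆ C ∧ C₁ ⊆ C ∧ Disjoint C₀ C₁ ∧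
    IsStableValue C₀ f y ∧ IsStableValue C₁ f y

lemma isOpen_setOf_splitsStably (𝓒 : Set (Set K)) (C : Set K) :
    IsOpen {p : C(K, Fin n → ℝ) × (Fin n → ℝ) | SplitsStably 𝓒 C p.1 p.2} := by
  simp only [SplitsStably, ofPred_exists, ofPred_and]
  refine isOpen_iUnion fun C₀ => isOpen_const.inter <| isOpen_iUnion fun C₁ =>
    isOpen_const.inter <| isOpen_const.inter <| isOpen_const.inter <| isOpen_const.inter <|
    (isOpen_setOf_isStableValue C₀).inter (isOpen_setOf_isStableValue C₁)

lemma isClosed_setOf_isStableWithin {C : Set K} (hC : IsClosed C) (ε : ℝ) :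
    IsClosed {p : C(K, Fin n → ℝ) × (Fin n → ℝ) | IsStableWithin ε C p.1 p.2} := by
  simp only [IsStableWithin, ofPred_forall]
  refine isClosed_iInter fun g => ?_
  have h : IsClosed ({p : C(K, Fin n → ℝ) × (Fin n → ℝ) | ε ≤ dist g p.1} ∪
      {p | p.2 ∈ g '' C}) :=
    (isClosed_le continuous_const (by fun_prop)).union
      ((hC.isCompact.image g.continuous).isClosed.preimage continuous_snd)
  convert h using 1
  ext p
  simp [imp_iff_not_or]

/-- The zigzag `t ↦ t + 4 s d(t / s, ℤ)`. -/
noncomputable def zigzag (s t : ℝ) : ℝ := t + 4 * s * ‖((t / s : ℝ) : UnitAddCircle)‖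

lemma continuous_zigzag (s : ℝ) : Continuous (zigzag s) := by
  have h : Continuous fun t : ℝ => ((t / s : ℝ) : UnitAddCircle) :=
    (AddCircle.continuous_mk' 1).comp (continuous_id.div_const s)
  unfold zigzag
  exact continuous_id.add (continuous_const.mul h.norm)

lemma abs_zigzag_sub_le {s : ℝ} (hs : 0 < s) (t : ℝ) : |zigzag s t - t| ≤ 2 * s := by
  have h := AddCircle.norm_le_half_period (1 : ℝ) (x := ((t / s : ℝ) : UnitAddCircle)) one_ne_zero
  rw [abs_one] at h
  rw [zigzag, add_sub_cancel_left, abs_of_nonneg (by positivity)]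
  nlinarith

lemma zigzag_eq {s t : ℝ} (hs : 0 < s) {k : ℤ} (h1 : s * k ≤ t) (h2 : t ≤ s * (k + 1 / 2)) :
    zigzag s t = 5 * t - 4 * s * k := by
  have h3 : (k : ℝ) ≤ t / s := by rw [le_div_iff₀ hs]; linarith
  have h4 : t / s ≤ k + 1 / 2 := by rw [div_le_iff₀ hs]; linarith
  have h5 : ‖((t / s : ℝ) : UnitAddCircle)‖ = t / s - k := by
    have h6 : ((t / s : ℝ) : UnitAddCircle) = ((t / s - k : ℝ) : UnitAddCircle) := by
      have h7 : ((k : ℝ) : UnitAddCircle) = 0 := by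
        rw [AddCircle.coe_eq_zero_iff]
        exact ⟨k, by simp⟩
      rw [AddCircle.coe_sub, h7, sub_zero]
    rw [h6, (AddCircle.norm_coe_eq_abs_iff 1 one_ne_zero).2, abs_of_nonneg (by linarith)]
    rw [abs_of_nonneg (by linarith), abs_one]
    linarith
  rw [zigzag, h5]
  field_simp
  ring

lemma isStableValue_of_affine {C : Set K} {f g : C(K, Fin n → ℝ)} {z : Fin n → ℝ}
    (h : IsStableValue C f z) (i : Fin n) (b : ℝ)
    (hg : ∀ x ∈ C, g x = Function.update (f x) i (5 * f x i - b)) :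
    IsStableValue C g (Function.update z i (5 * z i - b)) := by
  obtain ⟨ε, hε, h⟩ := h
  have hstab : IsStableValue C
      (⟨fun x => Function.update (f x) i (5 * f x i - b), by fun_prop⟩ : C(K, Fin n → ℝ))
      (Function.update z i (5 * z i - b)) := by
    refine ⟨ε, hε, fun k hk => ?_⟩
    obtain ⟨x, hx, hxz⟩ := h
      ⟨fun x => Function.update (k x) i ((k x i + b) / 5), by fun_prop⟩ (by
        rw [ContinuousMap.dist_lt_iff hε] at hk ⊢
        intro x
        refine (dist_pi_lt_iff hε).2 fun j => ?_
        have hkx := (dist_pi_lt_iff hε).1 (hk x) j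
        by_cases hj : j = i
        · subst hj
          simp only [ContinuousMap.coe_mk, Function.update_self, Real.dist_eq, abs_lt] at hkx ⊢
          constructor <;> linarith
        · simpa [hj] using hkx)
    refine ⟨x, hx, ?_⟩
    simp only [ContinuousMap.coe_mk] at hxz
    ext j
    have hj' := congrFun hxz j
    by_cases hj : j = i
    · subst hj
      simp only [Function.update_self] at hj' ⊢
      linarith
    · simpa [hj] using hj'
  exact hstab.congr fun x hx => (hg x hx).symm

lemma isStableValue_zigzag_comp {C : Set K} {f g : C(K, Fin n → ℝ)} {s δ : ℝ}
    (hs : 0 < s) (hδ : 4 * s < δ) (i : Fin n)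
    (hg : ∀ x, g x = Function.update (f x) i (zigzag s (f x i))) {y : Fin n → ℝ}
    (hy : IsStableWithin δ C g y) {k : ℤ} (h1 : s * k < y i) (h2 : y i < s * (k + 5 / 2)) :
    IsStableValue (C ∩ f ⁻¹' {w | w i ∈ Icc (s * k) (s * (k + 1 / 2))}) g y := by
  set t : ℝ := (y i + 4 * s * k) / 5 with ht
  have ht1 : s * k < t := by rw [ht]; linarith
  have ht2 : t < s * (k + 1 / 2) := by rw [ht]; linarith
  have hzt : zigzag s t = y i := by
    rw [zigzag_eq hs ht1.le ht2.le, ht]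
    ring
  set z : Fin n → ℝ := Function.update y i t with hz
  have hyz : dist y z ≤ 2 * s := by
    refine (dist_pi_le_iff (by positivity)).2 fun j => ?_
    by_cases hj : j = i
    · subst hj
      rw [hz, Function.update_self, Real.dist_eq, ← hzt]
      exact abs_zigzag_sub_le hs t
    · simp [hz, hj, hs.le]
  have hgf : dist g f ≤ 2 * s := by
    refine (ContinuousMap.dist_le (by positivity)).2 fun x => ?_
    refine (dist_pi_le_iff (by positivity)).2 fun j => ?_
    by_cases hj : j = i
    · subst hj
      rw [hg, Function.update_self, Real.dist_eq]
      exact abs_zigzag_sub_le hs _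
    · simp [hg, hj, hs.le]
  have hfz : IsStableValue C f z :=
    ⟨δ - 4 * s, by linarith, hy.of_dist (by linarith)⟩
  have hN : {w : Fin n → ℝ | w i ∈ Icc (s * k) (s * (k + 1 / 2))} ∈ 𝓝 z := by
    refine (continuous_apply i).continuousAt.preimage_mem_nhds (Icc_mem_nhds ?_ ?_)
    · simpa [hz] using ht1
    · simpa [hz] using ht2
  have := isStableValue_of_affine (hfz.inter_preimage hN) i (4 * s * k) (g := g) fun x hx => by
    rw [hg, zigzag_eq hs hx.2.1 hx.2.2]
  convert this using 1
  rw [hz, Function.update_self, Function.update_idem, ← zigzag_eq hs ht1.le ht2.le, hzt,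
    Function.update_eq_self]

lemma eventually_residual_splitsStably (hn : 0 < n) {𝓒 : Set (Set K)}
    (hinter : ∀ C ∈ 𝓒, ∀ D ∈ 𝓒, C ∩ D ∈ 𝓒)
    (hsep : ∀ F W : Set K, IsClosed F → IsOpen W → F ⊆ W → ∃ C ∈ 𝓒, F ⊆ C ∧ C ⊆ W)
    {C : Set K} (hC𝓒 : C ∈ 𝓒) (hC : IsClosed C) {δ : ℝ} (hδ : 0 < δ) :
    ∀ᶠ f : C(K, Fin n → ℝ) in residual C(K, Fin n → ℝ),
      ∀ x, IsStableWithin δ C f (f x) → SplitsStably 𝓒 C f (f x) := by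
  refine residual_of_dense_open ?_ ?_
  · have h : IsClosed {p : C(K, Fin n → ℝ) × K |
        IsStableWithin δ C p.1 (p.1 p.2) ∧ ¬ SplitsStably 𝓒 C p.1 (p.1 p.2)} :=
      ((isClosed_setOf_isStableWithin hC δ).inter
        (isOpen_setOf_splitsStably 𝓒 C).isClosed_compl).preimage
        (f := fun p : C(K, Fin n → ℝ) × K => (p.1, p.1 p.2)) (by fun_prop)
    rw [← isClosed_compl_iff]
    convert isClosedMap_fst_of_compactSpace _ h using 1
    ext f
    simp
  · rw [Metric.dense_iff]
    intro f r hr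
    set i : Fin n := ⟨0, hn⟩
    set s : ℝ := min r δ / 5 with hs
    have hs0 : 0 < s := by positivity
    have hsr : 5 * s ≤ r := by rw [hs]; linarith [min_le_left r δ]
    have hsδ : 5 * s ≤ δ := by rw [hs]; linarith [min_le_right r δ]
    have hzc := continuous_zigzag s
    set g : C(K, Fin n → ℝ) :=
      ⟨fun x => Function.update (f x) i (zigzag s (f x i)), by fun_prop⟩ with hgdef
    have hg (x : K) : g x = Function.update (f x) i (zigzag s (f x i)) := rfl
    refine ⟨g, ?_, fun x hx => ?_⟩
    · refine (ContinuousMap.dist_lt_iff hr).2 fun x => (dist_pi_lt_iff hr).2 fun j => ?_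
      by_cases hj : j = i
      · subst hj
        rw [hg, Function.update_self, Real.dist_eq]
        linarith [abs_zigzag_sub_le hs0 (f x i)]
      · simpa [hg, hj] using hr
    set y := g x
    set k : ℤ := ⌈y i / s⌉ - 1 with hk
    have hk1 : s * k < y i := by
      have h := Int.ceil_lt_add_one (y i / s)
      rw [mul_comm, ← lt_div_iff₀ hs0, hk]
      push_cast
      linarith
    have hk2 : y i ≤ s * (k + 1) := by
      have h := Int.le_ceil (y i / s)
      rw [mul_comm, ← div_le_iff₀ hs0, hk]
      push_cast
      linarith
    have st₀ := isStableValue_zigzag_comp hs0 (by linarith) i hg hx hk1 (by linarith)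
    have st₁ := isStableValue_zigzag_comp hs0 (by linarith) i hg hx (k := k - 1)
      (by push_cast; linarith) (by push_cast; linarith)
    set F : ℤ → Set K := fun l => C ∩ f ⁻¹' {w | w i ∈ Icc (s * l) (s * (l + 1 / 2))} with hF
    have hFc (l : ℤ) : IsClosed (F l) :=
      hC.inter ((isClosed_Icc.preimage (continuous_apply i)).preimage f.continuous)
    have hFd : Disjoint (F k) (F (k - 1)) := by
      refine Set.disjoint_left.2 fun w h0 h1 => ?_
      have h2 := h0.2.1
      have h3 := h1.2.2
      push_cast at h3
      linarith
    obtain ⟨W₀, W₁, hW₀, hW₁, hFW₀, hFW₁, hW⟩ := normal_separation (hFc k) (hFc (k - 1)) hFd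
    obtain ⟨C₀, hC₀, hF₀, hCW₀⟩ := hsep _ _ (hFc k) hW₀ hFW₀
    obtain ⟨C₁, hC₁, hF₁, hCW₁⟩ := hsep _ _ (hFc (k - 1)) hW₁ hFW₁
    exact ⟨C ∩ C₀, hinter _ hC𝓒 _ hC₀, C ∩ C₁, hinter _ hC𝓒 _ hC₁, inter_subset_left,
      inter_subset_left,
      hW.mono (inter_subset_right.trans hCW₀) (inter_subset_right.trans hCW₁),
      st₀.mono (subset_inter inter_subset_left hF₀),
      st₁.mono (subset_inter inter_subset_left hF₁)⟩

open CantorScheme in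
lemma mk_preimage_eq_continuum {𝓒 : Set (Set K)} (hclosed : ∀ C ∈ 𝓒, IsClosed C)
    {f : C(K, Fin n → ℝ)} {y : Fin n → ℝ}
    (hsplit : ∀ C ∈ 𝓒, IsStableValue C f y → SplitsStably 𝓒 C f y)
    {C : Set K} (hC : C ∈ 𝓒) (hst : IsStableValue C f y) :
    Cardinal.mk (f ⁻¹' {y}) = Cardinal.continuum := by
  have : SecondCountableTopology K := EMetric.secondCountable_of_sigmaCompact K
  refine le_antisymm ?_ ?_
  · borelize K
    obtain ⟨φ, -, hφ⟩ := MeasurableSpace.measurable_injection_nat_bool_of_countablySeparated K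
    refine (Cardinal.mk_set_le _).trans ?_
    simpa using Cardinal.lift_mk_le_lift_mk_of_injective hφ
  · choose! D₀ hD₀ D₁ hD₁ hsub₀ hsub₁ hdisj hst₀ hst₁ using hsplit
    let A : List Bool → Set K := fun l => l.rec C fun b _ D => bif b then D₁ D else D₀ D
    have hA : ∀ l, A l ∈ 𝓒 ∧ IsStableValue (A l) f y := by
      intro l
      induction l with
      | nil => exact ⟨hC, hst⟩
      | cons b l ih =>
        cases b
        · exact ⟨hD₀ _ ih.1 ih.2, hst₀ _ ih.1 ih.2⟩
        · exact ⟨hD₁ _ ih.1 ih.2, hst₁ _ ih.1 ih.2⟩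
    have hAd : CantorScheme.Disjoint A := by
      intro l a b hab
      have := hdisj _ (hA l).1 (hA l).2
      cases a <;> cases b
      · exact absurd rfl hab
      · exact this
      · exact this.symm
      · exact absurd rfl hab
    have hAsub (l : List Bool) (b : Bool) : A (b :: l) ⊆ A l := by
      cases b
      · exact hsub₀ _ (hA l).1 (hA l).2
      · exact hsub₁ _ (hA l).1 (hA l).2
    set B : List Bool → Set K := fun l => A l ∩ f ⁻¹' {y} with hB
    have hBd : CantorScheme.Disjoint B := fun l a b hab =>
      (hAd l hab).mono inter_subset_left inter_subset_left
    have hBc (l : List Bool) : IsClosed (B l) :=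
      (hclosed _ (hA l).1).inter (isClosed_singleton.preimage f.continuous)
    have hdom (σ : ℕ → Bool) : σ ∈ (inducedMap B).1 := by
      refine IsCompact.nonempty_iInter_of_sequence_nonempty_isCompact_isClosed
        (fun m => B (PiNat.res σ m)) (fun m => ?_) (fun m => ?_) (hBc (PiNat.res σ 0)).isCompact (fun m => hBc _)
      · rw [PiNat.res_succ]
        exact inter_subset_inter_left _ (hAsub _ _)
      · obtain ⟨x, hx, hxy⟩ := (hA (PiNat.res σ m)).2.mem_image
        exact ⟨x, hx, hxy⟩
    have hinj : Function.Injective fun σ : ℕ → Bool =>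
        (⟨(inducedMap B).2 ⟨σ, hdom σ⟩, (map_mem (⟨σ, hdom σ⟩ : (inducedMap B).1) 0).2⟩ :
          f ⁻¹' {y}) := by
      intro σ τ h
      have hval : (inducedMap B).2 ⟨σ, hdom σ⟩ = (inducedMap B).2 ⟨τ, hdom τ⟩ :=
        congrArg Subtype.val h
      exact congrArg Subtype.val (hBd.map_injective hval)
    have hle := Cardinal.lift_mk_le_lift_mk_of_injective hinj
    rw [Cardinal.lift_uzero] at hle
    refine le_trans (le_of_eq ?_) hle
    simp

end Splitting

/-- If common values of `f` on `n + 1` disjoint members of a separating family are stable, then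
fibers over the boundary of the image have at most `n` points. -/
lemma encard_preimage_le {K : Type*} [MetricSpace K] [CompactSpace K] {n : ℕ} {𝓒 : Set (Set K)}
    (hsep : ∀ F W : Set K, IsClosed F → IsOpen W → F ⊆ W → ∃ C ∈ 𝓒, F ⊆ C ∧ C ⊆ W)
    {f : C(K, Fin n → ℝ)}
    (hf : ∀ B : Fin (n + 1) → Set K, (∀ i, B i ∈ 𝓒) → Pairwise (Function.onFun Disjoint B) →
      ∀ x, (∀ i, f x ∈ f '' B i) → ∃ i, IsStableValue (B i) f (f x))
    {y : Fin n → ℝ} (hy : y ∈ frontier (range f)) : (f ⁻¹' {y}).encard ≤ n := by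
  by_contra! hlt
  have hle : ((n + 1 : ℕ) : ℕ∞) ≤ (f ⁻¹' {y}).encard := by
    push_cast
    exact Order.add_one_le_of_lt hlt
  obtain ⟨t, hty, ht⟩ := exists_subset_encard_eq hle
  have htf : t.Finite := finite_of_encard_eq_coe ht
  obtain ⟨U, hU, hUd⟩ := htf.t2_separation
  have hcard : Nat.card t = n + 1 := by
    rw [Nat.card_coe_set_eq, ncard_def, ht]
    rfl
  have := htf.to_subtype
  let e : Fin (n + 1) ≃ t := (Finite.equivFinOfCardEq hcard).symm
  choose C hC hxC hCU using fun i : Fin (n + 1) =>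
    hsep {(e i : K)} (U (e i)) isClosed_singleton (hU _).2 (by simpa using (hU _).1)
  have hfe (i) : f (e i) = y := hty (e i).2
  obtain ⟨i, hi⟩ := hf C hC (fun i j hij => (hUd (e i).2 (e j).2 (fun h =>
    hij (e.injective (Subtype.ext h)))).mono (hCU i) (hCU j)) (e 0) (fun i =>
      ⟨e i, hxC i rfl, by rw [hfe, hfe]⟩)
  rw [hfe] at hi
  exact hy.2 hi.mem_interior_range

/-- Generic fibers over the boundary of the image have at most `n` points, and generic fibers
over the interior of the image have cardinality `2^ℵ₀`. -/
theorem stmt8 (n : ℕ) (hn : 0 < n) (K : Type*) [MetricSpace K] [CompactSpace K]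
    (hK : (n : EReal) ≤ tdim (Set.univ : Set K)) :
    ∀ᶠ (f : C(K, Fin n → ℝ)) in residual C(K, Fin n → ℝ),
      (∀ y ∈ frontier (Set.range ⇑f), (⇑f ⁻¹' {y}).encard ≤ (n : ℕ∞)) ∧
      (∀ y ∈ interior (Set.range ⇑f), Cardinal.mk (⇑f ⁻¹' {y}) = Cardinal.continuum) := by
  obtain ⟨𝓒, hcount, hclosed, huniv, hinter, hsep⟩ := exists_countable_closed_family K
  have hcount' : {B : Fin (n + 1) → Set K | ∀ i, B i ∈ 𝓒}.Countable := by
    simpa [Set.pi] using countable_univ_pi (fun _ : Fin (n + 1) => hcount)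
  have hfew : ∀ᶠ f : C(K, Fin n → ℝ) in residual C(K, Fin n → ℝ),
      ∀ B ∈ {B : Fin (n + 1) → Set K | ∀ i, B i ∈ 𝓒}, Pairwise (Function.onFun Disjoint B) →
        ∀ x, (∀ i, f x ∈ f '' B i) → ∃ i, IsStableValue (B i) f (f x) := by
    refine (eventually_countable_ball hcount').2 fun B hB => ?_
    by_cases hd : Pairwise (Function.onFun Disjoint B)
    · filter_upwards [eventually_residual_exists_isStableValue (fun i => hclosed _ (hB i)) hd]
        with f hf _ using hf
    · exact Eventually.of_forall fun f hd' => absurd hd' hd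
  have hsplit : ∀ᶠ f : C(K, Fin n → ℝ) in residual C(K, Fin n → ℝ),
      ∀ C ∈ 𝓒, ∀ m : ℕ, ∀ x, IsStableWithin (1 / (m + 1)) C f (f x) →
        SplitsStably 𝓒 C f (f x) :=
    (eventually_countable_ball hcount).2 fun C hC => eventually_countable_forall.2 fun m =>
      eventually_residual_splitsStably hn hinter hsep hC (hclosed C hC) Nat.one_div_pos_of_nat
  filter_upwards [hfew, hsplit, eventually_residual_interior_isStableValue] with f hf1 hf2 hf3
  refine ⟨fun y hy => encard_preimage_le hsep hf1 hy, fun y hy => ?_⟩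
  refine mk_preimage_eq_continuum hclosed (fun C hC hst => ?_) huniv (hf3 y hy)
  obtain ⟨x, -, rfl⟩ := hst.mem_image
  obtain ⟨ε, hε, hst⟩ := hst
  obtain ⟨m, hm⟩ := exists_nat_one_div_lt hε
  exact hf2 C hC m x fun g hg => hst g (hg.trans hm)
end
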